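/- arXiv:1504.01154 — 3 statements merged into one kernel-verified Lean document; each statement's English description precedes it below -/
import Mathlib

section
/- Let d ≥ 2 and let l = (a_1, …, a_m) be a ramification distribution of degree d, i.e. 2 ≤ a_i ≤ d for every i and ∑_{i=1}^{m} (a_i − 1) = 2d − 2. Then there exists an m×d matrix A with entries in {0,1} such that the i-th row of A contains exactly a_i ones for every i, and A satisfies the balanced condition: for every nonempty set S of k columns of A, ∑_{i=1}^{m} (max(1, ∑_{j∈S} A_{ij}) − 1) ≤ 2k − 2. -/
open Finset

/-- A family of naturals bounded by `n + 1` with sum `2 * (n + 1)` has two distinct positive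
members such that all the other ones are at most `n`. -/
lemma exists_pair_pos_forall_le {ι : Type*} [Fintype ι] [DecidableEq ι] {n : ℕ} {b : ι → ℕ}
    (hb : ∀ i, b i ≤ n + 1) (hsum : ∑ i, b i = 2 * (n + 1)) :
    ∃ p q, p ≠ q ∧ 1 ≤ b p ∧ 1 ≤ b q ∧ ∀ r, r ≠ p → r ≠ q → b r ≤ n := by
  have hne : (univ : Finset ι).Nonempty := by
    by_contra h
    rw [not_nonempty_iff_eq_empty] at h
    simp [h] at hsum
  obtain ⟨p, -, hp⟩ := exists_max_image univ b hne
  have hp_add := add_sum_erase univ b (mem_univ p)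
  have hbp := hb p
  obtain ⟨s, hs, hs_pos⟩ : ∃ s ∈ univ.erase p, b s ≠ 0 := by
    apply exists_ne_zero_of_sum_ne_zero
    omega
  obtain ⟨q, hq, hq_max⟩ := exists_max_image (univ.erase p) b ⟨s, hs⟩
  have hq_add := add_sum_erase _ b hq
  have hsq := hq_max s hs
  have hqp := hp q (mem_univ q)
  refine ⟨p, q, (ne_of_mem_erase hq).symm, by omega, by omega, fun r hrp hrq => ?_⟩
  have hr : r ∈ univ.erase p := mem_erase.2 ⟨hrp, mem_univ r⟩
  have hrq_le := hq_max r hr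
  have hr_le : b r ≤ ∑ i ∈ (univ.erase p).erase q, b i :=
    single_le_sum_of_canonicallyOrdered (mem_erase.2 ⟨hrq, hr⟩)
  omega

/-- Every family `b` bounded by `n` with sum `2 * n` is realised by subsets of `{0, …, n}` of
sizes `b i + 1` that form a balanced family. -/
lemma exists_balanced_finset_family {ι : Type*} [Fintype ι] [DecidableEq ι] (n : ℕ) (b : ι → ℕ)
    (hb : ∀ i, b i ≤ n) (hsum : ∑ i, b i = 2 * n) :
    ∃ A : ι → Finset ℕ, (∀ i, A i ⊆ range (n + 1)) ∧ (∀ i, #(A i) = b i + 1) ∧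
      ∀ S ⊆ range (n + 1), S.Nonempty → ∑ i, (#(A i ∩ S) - 1) ≤ 2 * (#S - 1) := by
  induction n generalizing b with
  | zero =>
    refine ⟨fun _ => {0}, by simp, fun i => by simpa using hb i, fun S _ _ => ?_⟩
    refine (sum_eq_zero fun i _ => ?_).trans_le (Nat.zero_le _)
    exact Nat.sub_eq_zero_of_le (card_le_card inter_subset_left)
  | succ n ih =>
    obtain ⟨p, q, hpq, hp, hq, hr⟩ := exists_pair_pos_forall_le hb hsum
    let e : ι → ℕ := fun i => (if i = p then 1 else 0) + (if i = q then 1 else 0)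
    have he : ∑ i, e i = 2 := by simp [e, sum_add_distrib]
    have heb (i : ι) : e i ≤ b i ∧ e i ≤ 1 ∧ b i - e i ≤ n := by
      have := hb i
      by_cases hip : i = p
      · subst hip; simp [e, hpq]; omega
      · by_cases hiq : i = q
        · subst hiq; simp [e, hip]; omega
        · simpa [e, hip, hiq] using hr i hip hiq
    have hsum' : ∑ i, (b i - e i) = 2 * n := by
      have : ∑ i, (b i - e i) + ∑ i, e i = ∑ i, b i := by
        rw [← sum_add_distrib]
        exact sum_congr rfl fun i _ => Nat.sub_add_cancel (heb i).1
      omega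
    obtain ⟨A, hA, hcard, hbal⟩ := ih (fun i => b i - e i) (fun i => (heb i).2.2) hsum'
    have hv (i : ι) : n + 1 ∉ A i := fun h => by simpa using hA i h
    refine ⟨fun i => if e i = 1 then insert (n + 1) (A i) else A i, fun i => ?_, fun i => ?_,
      fun S hS hne => ?_⟩
    · have hsub : A i ⊆ range (n + 1 + 1) := (hA i).trans (range_mono (by omega))
      dsimp only
      split_ifs
      · exact insert_subset (by simp) hsub
      · exact hsub
    · have := hcard i
      have := heb i
      dsimp only
      split_ifs
      · rw [card_insert_of_notMem (hv i)]; omega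
      · omega
    · dsimp only
      have hT : S.erase (n + 1) ⊆ range (n + 1) := fun x hx => by
        have h1 := ne_of_mem_erase hx
        have h2 := mem_range.1 (hS (mem_of_mem_erase hx))
        exact mem_range.2 (by omega)
      by_cases hvS : n + 1 ∈ S
      · have hScard := card_erase_add_one hvS
        have hle (i : ι) : #((if e i = 1 then insert (n + 1) (A i) else A i) ∩ S)
            ≤ #(A i ∩ S.erase (n + 1)) + e i := by
          have hAS : A i ∩ S.erase (n + 1) = A i ∩ S := by
            rw [inter_erase, erase_eq_of_notMem fun h => hv i (mem_inter.1 h).1]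
          rw [hAS]
          split_ifs with h
          · rw [insert_inter_of_mem hvS, h]
            exact card_insert_le _ _
          · omega
        rcases (S.erase (n + 1)).eq_empty_or_nonempty with hempty | hnonempty
        · refine (sum_eq_zero fun i _ => ?_).trans_le (Nat.zero_le _)
          have h1 := hle i
          have h2 := (heb i).2.1
          simp only [hempty, inter_empty, card_empty] at h1
          omega
        · have hpos := hnonempty.card_pos
          have hB := hbal _ hT hnonempty
          calc _ ≤ ∑ i, ((#(A i ∩ S.erase (n + 1)) - 1) + e i) :=
                sum_le_sum fun i _ => by have := hle i; omega
            _ ≤ _ := by rw [sum_add_distrib, he]; omega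
      · rw [erase_eq_of_notMem hvS] at hT
        refine (sum_congr rfl fun i _ => ?_).trans_le (hbal S hT hne)
        split_ifs
        · rw [insert_inter_of_notMem hvS]
        · rfl

/-- Every ramification distribution of degree `d` admits a matrix representation
(a `{0,1}`-matrix whose `i`-th row has exactly `a i` ones) satisfying the balanced
condition. -/
theorem exists_balanced_matrix_representation (d : ℕ) (hd : 2 ≤ d) (m : ℕ)
    (a : Fin m → ℕ) (ha : ∀ i, 2 ≤ a i ∧ a i ≤ d)
    (hsum : (Finset.univ.sum fun i => a i - 1) = 2 * d - 2) :
    ∃ A : Matrix (Fin m) (Fin d) ℕ,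
      (∀ i j, A i j = 0 ∨ A i j = 1) ∧
      (∀ i, (Finset.univ.filter fun j => A i j = 1).card = a i) ∧
      ∀ S : Finset (Fin d), S.Nonempty →
        (Finset.univ.sum fun i => max 1 (S.sum fun j => A i j) - 1)
          ≤ 2 * S.card - 2 := by
  obtain ⟨n, rfl⟩ : ∃ n, d = n + 1 := ⟨d - 1, by omega⟩
  obtain ⟨A, hA, hcard, hbal⟩ := exists_balanced_finset_family n (fun i => a i - 1)
    (fun i => by have := ha i; omega) (by rw [hsum]; omega)
  refine ⟨fun i j => if (j : ℕ) ∈ A i then 1 else 0, fun i j => ?_, fun i => ?_, fun S hS => ?_⟩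
  · dsimp only
    split_ifs <;> simp
  · have himage : (univ.filter fun j : Fin (n + 1) => (j : ℕ) ∈ A i).map Fin.valEmbedding
        = A i := by
      ext x
      simp only [mem_map, mem_filter, mem_univ, true_and, Fin.valEmbedding_apply]
      exact ⟨fun ⟨j, hj, hjx⟩ => hjx ▸ hj, fun hx => ⟨⟨x, mem_range.1 (hA i hx)⟩, hx, rfl⟩⟩
    have h := hcard i
    rw [← himage, card_map] at h
    have := ha i
    simp only [ite_eq_left_iff, zero_ne_one, imp_false, not_not]
    omega
  · have hsub : S.map Fin.valEmbedding ⊆ range (n + 1) := fun x hx => by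
      obtain ⟨j, -, rfl⟩ := mem_map.1 hx
      exact mem_range.2 j.isLt
    have h := hbal _ hsub hS.map
    rw [card_map] at h
    have hrow (i : Fin m) : ∑ j ∈ S, (if (j : ℕ) ∈ A i then 1 else 0)
        = #(A i ∩ S.map Fin.valEmbedding) := by
      rw [← card_filter, inter_comm, ← filter_mem_eq_inter, filter_map, card_map]
      rfl
    calc _ = ∑ i, (#(A i ∩ S.map Fin.valEmbedding) - 1) :=
          sum_congr rfl fun i _ => by rw [hrow]; omega
      _ ≤ _ := by omega
end

section
/- Let d ≥ 2 and let l = (a_1, …, a_m) be a ramification distribution of degree d, i.e. 2 ≤ a_i ≤ d for every i and ∑_{i=1}^{m} (a_i − 1) = 2d − 2. Then there exists an m×d matrix A with entries in {0,1} such that the i-th row of A contains exactly a_i ones for every i, every column of A contains at least 2 and at most 4 ones, and any two distinct columns of A have inner product at most 2 (i.e. for all columns j ≠ k, the number of rows i with A_{ij} = A_{ik} = 1 is at most 2). -/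
/-- A finset of a linear order with no three-term strictly increasing chain has at most
two elements. -/
lemma card_le_two_of_no_chain {α : Type*} [LinearOrder α] (t : Finset α)
    (h : ∀ i ∈ t, ∀ j ∈ t, ∀ l ∈ t, i < j → j < l → False) : t.card ≤ 2 := by
  by_contra! hc
  obtain ⟨x, y, z, hx, hy, hz, hxy, hxz, hyz⟩ := Finset.two_lt_card_iff.1 hc
  rcases lt_or_gt_of_ne hxy with h1 | h1 <;> rcases lt_or_gt_of_ne hxz with h2 | h2 <;>
    rcases lt_or_gt_of_ne hyz with h3 | h3
  all_goals first
    | exact h x hx y hy z hz ‹_› ‹_›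
    | exact h x hx z hz y hy ‹_› ‹_›
    | exact h y hy x hx z hz ‹_› ‹_›
    | exact h y hy z hz x hx ‹_› ‹_›
    | exact h z hz x hx y hy ‹_› ‹_›
    | exact h z hz y hy x hx ‹_› ‹_›

/-- Position of the column `c` on the second chain, which occupies `D, …, 2 * D`: it runs through
the columns `s, s - 1, …, 0, D, D - 1, …, s + 1`. -/
def secondPos (D s c : ℕ) : ℕ := if c ≤ s then D + s - c else 2 * D + s + 1 - c

/-- Row `i` covers the positions `S i, …, S (i + 1)`. Rows up to `k` meet the first chain
`0, …, D` of columns, rows from `k` on meet the second one; row `k` straddles both. -/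
def ChainIncident (S : ℕ → ℕ) (D k i c : ℕ) : Prop :=
  (i ≤ k ∧ S i ≤ c ∧ c ≤ S (i + 1)) ∨
    (k ≤ i ∧ S i ≤ secondPos D (S k) c ∧ secondPos D (S k) c ≤ S (i + 1))

/-- The partial sums `S` of `m` positive steps of size at most `D`, with total `2 * D`, together
with the index `k` of the step that reaches `D`. -/
structure IsStraddle (S : ℕ → ℕ) (D m k : ℕ) : Prop where
  zero : S 0 = 0
  total : S m = 2 * D
  lt_succ : ∀ i < m, S i < S (i + 1)
  succ_le : ∀ i < m, S (i + 1) ≤ S i + D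
  lt_mid : S k < D
  mid_le : D ≤ S (k + 1)
  index_lt : k < m

lemma exists_isStraddle {S : ℕ → ℕ} {D m : ℕ} (hD : 0 < D) (zero : S 0 = 0)
    (total : S m = 2 * D) (lt_succ : ∀ i < m, S i < S (i + 1))
    (succ_le : ∀ i < m, S (i + 1) ≤ S i + D) : ∃ k, IsStraddle S D m k := by
  classical
  have hex : ∃ n, D ≤ S n := ⟨m, by omega⟩
  have hn := Nat.find_spec hex
  have hle : Nat.find hex ≤ m := Nat.find_min' hex (by omega)
  obtain ⟨k, hk⟩ : ∃ k, Nat.find hex = k + 1 :=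
    Nat.exists_eq_succ_of_ne_zero fun h => by rw [h] at hn; omega
  have hlt := Nat.find_min hex (m := k) (by omega)
  rw [hk] at hn hle
  exact ⟨k, zero, total, lt_succ, succ_le, by omega, hn, by omega⟩

namespace IsStraddle

variable {S : ℕ → ℕ} {D m k : ℕ}

lemma mono (h : IsStraddle S D m k) {i j : ℕ} (hij : i ≤ j) (hj : j ≤ m) : S i ≤ S j := by
  induction j, hij using Nat.le_induction with
  | base => rfl
  | succ j _ ih => exact (ih (by omega)).trans (h.lt_succ j (by omega)).le

lemma mid_succ_le (h : IsStraddle S D m k) : S (k + 1) ≤ S k + D :=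
  h.succ_le k h.index_lt

open Classical in
lemma card_row (h : IsStraddle S D m k) {i : ℕ} (hi : i < m) :
    (Finset.univ.filter fun c : Fin (D + 1) => ChainIncident S D k i c).card
      = S (i + 1) - S i + 1 := by
  have hlt := h.lt_succ i hi
  have hmid := h.lt_mid
  have hmid' := h.mid_le
  have hmid'' := h.mid_succ_le
  have hlast : S (i + 1) ≤ 2 * D := h.total ▸ h.mono (by omega) le_rfl
  rcases lt_trichotomy i k with hik | rfl | hik
  · have hle : S (i + 1) ≤ S k := h.mono hik h.index_lt.le
    trans (Finset.Icc (S i) (S (i + 1))).card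
    · refine Finset.card_bij (fun c _ => (c : ℕ)) ?_ (fun _ _ _ _ => Fin.ext) ?_
      · simp only [Finset.mem_filter_univ, Finset.mem_Icc]
        simp only [ChainIncident]
        omega
      · simp only [Finset.mem_filter_univ, Finset.mem_Icc]
        simp only [ChainIncident]
        exact fun b hb => ⟨⟨b, by omega⟩, Or.inl ⟨hik.le, hb⟩, rfl⟩
    · rw [Nat.card_Icc]; omega
  · trans (Finset.Icc (S i - (S (i + 1) - D)) D).card
    · refine Finset.card_bij (fun c _ => (c : ℕ)) ?_ (fun _ _ _ _ => Fin.ext) ?_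
      · simp only [Finset.mem_filter_univ, Finset.mem_Icc]
        simp only [ChainIncident, secondPos]
        intro c hc
        split_ifs at hc <;> omega
      · simp only [Finset.mem_filter_univ, Finset.mem_Icc]
        simp only [ChainIncident, secondPos]
        refine fun b hb => ⟨⟨b, by omega⟩, ?_, rfl⟩
        dsimp only
        split_ifs <;> omega
    · rw [Nat.card_Icc]; omega
  · have hle : S (k + 1) ≤ S i := h.mono hik hi.le
    trans (Finset.Icc (S i) (S (i + 1))).card
    · refine Finset.card_bij (fun c _ => secondPos D (S k) c) ?_ ?_ ?_
      · simp only [Finset.mem_filter_univ, Finset.mem_Icc]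
        simp only [ChainIncident]
        omega
      · intro c _ e _ hce
        simp only [secondPos] at hce
        ext
        split_ifs at hce <;> omega
      · simp only [Finset.mem_filter_univ, Finset.mem_Icc]
        simp only [ChainIncident]
        intro b hb
        have key : secondPos D (S k)
            (if b ≤ D + S k then D + S k - b else 2 * D + S k + 1 - b) = b := by
          simp only [secondPos]
          split_ifs <;> omega
        refine ⟨⟨if b ≤ D + S k then D + S k - b else 2 * D + S k + 1 - b, ?_⟩, ?_, key⟩
        · split_ifs <;> omega
        · exact Or.inr ⟨hik.le, by rw [key]; exact hb⟩
    · rw [Nat.card_Icc]; omega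

open Classical in
lemma card_position_le_two (h : IsStraddle S D m k) (p : ℕ) :
    (Finset.univ.filter fun i : Fin m => S i ≤ p ∧ p ≤ S (i + 1)).card ≤ 2 := by
  refine card_le_two_of_no_chain _ fun i hi j hj l hl hij hjl => ?_
  simp only [Finset.mem_filter_univ] at hi hj hl
  have h1 : S (i + 1) ≤ S j := h.mono hij j.2.le
  have h2 : S (j + 1) ≤ S l := h.mono hjl l.2.le
  have h3 := h.lt_succ j j.2
  omega

open Classical in
lemma card_column_le_four (h : IsStraddle S D m k) (c : ℕ) :
    (Finset.univ.filter fun i : Fin m => ChainIncident S D k i c).card ≤ 4 := by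
  have h1 := h.card_position_le_two c
  have h2 := h.card_position_le_two (secondPos D (S k) c)
  refine (Finset.card_le_card ?_).trans ((Finset.card_union_le _ _).trans (Nat.add_le_add h1 h2))
  intro i
  simp only [Finset.mem_union, Finset.mem_filter_univ]
  simp only [ChainIncident]
  tauto

open Classical in
lemma two_le_card_column (h : IsStraddle S D m k) {c : ℕ} (hc : c ≤ D) :
    2 ≤ (Finset.univ.filter fun i : Fin m => ChainIncident S D k i c).card := by
  have hmid := h.lt_mid
  have hmid' := h.mid_le
  have hmid'' := h.mid_succ_le
  have hkm := h.index_lt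
  have hpos : D ≤ secondPos D (S k) c ∧ secondPos D (S k) c ≤ 2 * D := by
    simp only [secondPos]; split_ifs <;> omega
  obtain ⟨i, hik, hi, hi', himin⟩ :
      ∃ i ≤ k, S i ≤ c ∧ c ≤ S (i + 1) ∧ (i = 0 ∨ S i < c) := by
    have hex : ∃ n, c ≤ S (n + 1) := ⟨k, by omega⟩
    have hle : Nat.find hex ≤ k := Nat.find_min' hex (by omega)
    have hspec := Nat.find_spec hex
    rcases hn : Nat.find hex with _ | n
    · rw [hn] at hspec
      exact ⟨0, by omega, by rw [h.zero]; omega, hspec, Or.inl rfl⟩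
    · have := Nat.find_min hex (m := n) (by omega)
      rw [hn] at hspec hle
      exact ⟨n + 1, hle, by omega, hspec, Or.inr (by omega)⟩
  obtain ⟨j, hkj, hjm, hj, hj', hjmax⟩ :
      ∃ j ≥ k, j < m ∧ S j ≤ secondPos D (S k) c ∧ secondPos D (S k) c ≤ S (j + 1) ∧
        (j + 1 = m ∨ secondPos D (S k) c < S (j + 1)) := by
    have hk : S k ≤ secondPos D (S k) c := by omega
    have hspec := Nat.findGreatest_spec (P := fun n => S n ≤ secondPos D (S k) c)
      (Nat.le_sub_one_of_lt hkm) hk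
    have hge := Nat.le_findGreatest (P := fun n => S n ≤ secondPos D (S k) c)
      (Nat.le_sub_one_of_lt hkm) hk
    have hle := Nat.findGreatest_le (P := fun n => S n ≤ secondPos D (S k) c) (m - 1)
    generalize hg : Nat.findGreatest (fun n => S n ≤ secondPos D (S k) c) (m - 1) = j at *
    by_cases hjm : j + 1 = m
    · exact ⟨j, hge, by omega, hspec, by rw [hjm, h.total]; exact hpos.2, Or.inl hjm⟩
    · have := Nat.findGreatest_is_greatest (P := fun n => S n ≤ secondPos D (S k) c)
        (n := m - 1) (k := j + 1) (by omega) (by omega)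
      exact ⟨j, hge, by omega, hspec, by omega, Or.inr (by omega)⟩
  have hij : i ≠ j := by
    rintro rfl
    obtain rfl : i = k := by omega
    have hm : i + 1 ≠ m := fun he => by
      have := h.total
      rw [he] at hmid''
      omega
    have hlt : secondPos D (S i) c < S (i + 1) := by tauto
    simp only [secondPos] at hlt
    rcases himin with rfl | hlt'
    · have := h.zero
      split_ifs at hlt <;> omega
    · split_ifs at hlt <;> omega
  refine Finset.one_lt_card.2 ⟨⟨i, by omega⟩, ?_, ⟨j, hjm⟩, ?_, by simpa using hij⟩
  · simp only [Finset.mem_filter_univ]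
    exact Or.inl ⟨hik, hi, hi'⟩
  · simp only [Finset.mem_filter_univ]
    exact Or.inr ⟨hkj, hj, hj'⟩

open Classical in
lemma card_common_le_two (h : IsStraddle S D m k) {c e : ℕ} (hc : c ≤ D) (he : e ≤ D)
    (hce : c ≠ e) :
    (Finset.univ.filter fun i : Fin m =>
      ChainIncident S D k i c ∧ ChainIncident S D k i e).card ≤ 2 := by
  refine card_le_two_of_no_chain _ fun i hi j hj l hl hij hjl => ?_
  rw [Finset.mem_filter_univ] at hi hj hl
  simp only [ChainIncident] at hi hj hl
  have hmid := h.lt_mid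
  have h1 : S (i + 1) ≤ S j := h.mono hij j.2.le
  have h2 : S (j + 1) ≤ S l := h.mono hjl l.2.le
  rw [Fin.lt_def] at hij hjl
  have hinj : secondPos D (S k) c ≠ secondPos D (S k) e := by
    simp only [secondPos]; split_ifs <;> omega
  rcases lt_trichotomy (j : ℕ) k with hjk | hjk | hjk
  · omega
  · have hpos : ∀ x, S k ≤ x → x ≤ S k → secondPos D (S k) x = D := by
      intro x hx hx'
      simp only [secondPos]; split_ifs; omega
    have hmid' := h.mid_le
    have hc' := hpos c
    have he' := hpos e
    rw [hjk] at h1 h2 hj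
    omega
  · omega

end IsStraddle

/-- Every ramification distribution of degree `d` admits a matrix representation
in which every column has between 2 and 4 ones and any two distinct columns have
inner product at most 2. -/
theorem exists_matrix_representation_column_bounds (d : ℕ) (hd : 2 ≤ d) (m : ℕ)
    (a : Fin m → ℕ) (ha : ∀ i, 2 ≤ a i ∧ a i ≤ d)
    (hsum : (Finset.univ.sum fun i => a i - 1) = 2 * d - 2) :
    ∃ A : Matrix (Fin m) (Fin d) ℕ,
      (∀ i j, A i j = 0 ∨ A i j = 1) ∧
      (∀ i, (Finset.univ.filter fun j => A i j = 1).card = a i) ∧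
      (∀ j, 2 ≤ (Finset.univ.filter fun i => A i j = 1).card ∧
            (Finset.univ.filter fun i => A i j = 1).card ≤ 4) ∧
      ∀ j k, j ≠ k →
        (Finset.univ.filter fun i => A i j = 1 ∧ A i k = 1).card ≤ 2 := by
  classical
  obtain ⟨D, rfl⟩ : ∃ D, d = D + 1 := ⟨d - 1, by omega⟩
  let b : ℕ → ℕ := fun n => if hn : n < m then a ⟨n, hn⟩ - 1 else 0
  have hb : ∀ i : Fin m, b i = a i - 1 := fun i => by simp [b]
  let S : ℕ → ℕ := fun n => ∑ i ∈ Finset.range n, b i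
  have hS : ∀ n, S (n + 1) = S n + b n := fun n => Finset.sum_range_succ b n
  obtain ⟨k, h⟩ : ∃ k, IsStraddle S D m k := by
    refine exists_isStraddle (by omega) (by simp [S]) ?_ (fun i hi => ?_) (fun i hi => ?_)
    · simp only [S, Finset.sum_range, hb]
      omega
    all_goals
      have h1 := hS i
      have h2 := hb ⟨i, hi⟩
      have h3 := ha ⟨i, hi⟩
      dsimp only at h2
      omega
  refine ⟨fun i c => if ChainIncident S D k i c then 1 else 0, fun i c => ?_, fun i => ?_,
    fun c => ?_, fun c e hce => ?_⟩
  · dsimp only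
    split_ifs <;> simp
  · have h1 := h.card_row i.2
    have h2 := hS i
    have h3 := hb i
    have h4 := ha i
    simp only [ite_eq_left_iff, zero_ne_one, imp_false, not_not]
    omega
  · simp only [ite_eq_left_iff, zero_ne_one, imp_false, not_not]
    exact ⟨h.two_le_card_column (by omega), h.card_column_le_four c⟩
  · simp only [ite_eq_left_iff, zero_ne_one, imp_false, not_not]
    exact h.card_common_le_two (by omega) (by omega) (by simpa [Fin.ext_iff] using hce)
end

section
/- Let π : 𝕊² → 𝕊² be a branched covering of degree d ≥ 2 with finite branch set F and ramification numbers e. Let n be the number of critical values of π and m the number of critical points of π. Then 2 ≤ n ≤ m ≤ 2d − 2. -/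
/-- The 2-sphere, as a topological space. -/
abbrev Sphere2 : Type := ↥(Metric.sphere (0 : EuclideanSpace ℝ (Fin 3)) 1)

/-- The open unit disc in `ℂ`. -/
abbrev unitDisc : Set ℂ := Metric.ball (0 : ℂ) 1

/-- `π : 𝕊² → 𝕊²` is a branched covering of degree `d` with finite branch set `F`
and ramification numbers `e`. -/
structure IsBranchedCovering (d : ℕ) (π : Sphere2 → Sphere2) (F : Set Sphere2)
    (e : Sphere2 → ℕ) : Prop where
  continuous : Continuous π
  finiteBranch : F.Finite
  covering : IsCoveringMap fun x : ((π ⁻¹' F)ᶜ : Set Sphere2) =>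
    (⟨π x.1, x.2⟩ : (Fᶜ : Set Sphere2))
  fiber_card : ∀ x : Sphere2, x ∉ F → Nat.card ↥(π ⁻¹' {x}) = d
  ram_eq_one : ∀ y : Sphere2, π y ∉ F → e y = 1
  ram : ∀ y : Sphere2, π y ∈ F → 1 ≤ e y ∧
    ∃ (U V : Set Sphere2) (_hUo : IsOpen U) (_hVo : IsOpen V) (hyU : y ∈ U)
      (hyV : π y ∈ V) (hmaps : Set.MapsTo π U V)
      (h : ↥U ≃ₜ ↥unitDisc) (g : ↥V ≃ₜ ↥unitDisc),
      (h ⟨y, hyU⟩ : ℂ) = 0 ∧ (g ⟨π y, hyV⟩ : ℂ) = 0 ∧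
      ∀ z (hz : z ∈ U), (g ⟨π z, hmaps hz⟩ : ℂ) = (h ⟨z, hz⟩ : ℂ) ^ (e y)

open Complex Metric Set Topology

theorem Convex.isSimplyConnected_of_nonempty {s : Set ℂ} (hs : Convex ℝ s) (hne : s.Nonempty) :
    IsSimplyConnected s :=
  have := hs.contractibleSpace hne
  inferInstanceAs (SimplyConnectedSpace s)

theorem exists_zpow_mul_exp_of_ball_diff_center {q : ℂ} {r : ℝ} (hr : 0 < r) {f : ℂ → ℂ}
    (hf : ContinuousOn f (ball q r \ {q})) (h0 : ∀ z ∈ ball q r \ {q}, f z ≠ 0) :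
    ∃ (n : ℤ) (l : ℂ → ℂ), ContinuousOn l (ball q r \ {q}) ∧
      ∀ z ∈ ball q r \ {q}, f z = (z - q) ^ n * exp (l z) := by
  set H : Set ℂ := {w | w.re < Real.log r} with hH
  have hHc : Convex ℝ H := convex_halfSpace_re_lt _
  have hHo : IsOpen H := isOpen_lt continuous_re continuous_const
  have hmem : ∀ w : ℂ, w ∈ H ↔ q + exp w ∈ ball q r \ {q} := fun w ↦ by
    simp [hH, norm_exp, ← Real.lt_log_iff_exp_lt hr]
  have hne : H.Nonempty := ⟨((Real.log r - 1 : ℝ) : ℂ), by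
    rw [hH, mem_ofPred_eq, ofReal_re]; linarith⟩
  have hsc : IsSimplyConnected H := hHc.isSimplyConnected_of_nonempty hne
  obtain ⟨L, hLc, hL⟩ := exists_continuousOn_eqOn_exp_comp (g := fun w ↦ f (q + exp w)) hsc hHo
    (hf.comp (by fun_prop) fun w hw ↦ (hmem w).1 hw)
    (by rintro ⟨w, hw, h⟩; exact h0 _ ((hmem w).1 hw) h)
  have hshift : ∀ w ∈ H, w + 2 * Real.pi * I ∈ H := fun w hw ↦ by
    rw [hmem] at hw ⊢
    rwa [exp_add, exp_two_pi_mul_I, mul_one]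
  have hLs : ∀ w ∈ H, exp (L (w + 2 * Real.pi * I)) = exp (L w) := fun w hw ↦ by
    have h1 := hL (hshift w hw)
    have h2 := hL hw
    simp only [Function.comp_apply, exp_add, exp_two_pi_mul_I, mul_one] at h1 h2
    rw [h1, h2]
  obtain ⟨w₀, hw₀⟩ := hne
  obtain ⟨n, hn⟩ := exp_eq_exp_iff_exists_int.1 (hLs w₀ hw₀)
  have hper : EqOn (fun w ↦ L (w + 2 * Real.pi * I)) (fun w ↦ L w + n * (2 * Real.pi * I)) H := by
    refine isCoveringMap_exp.eqOn_of_comp_eqOn hHc.isPreconnected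
      (hLc.comp (by fun_prop) hshift) (by fun_prop) (fun w hw ↦ Subtype.ext ?_) hw₀ hn
    simp only [Function.comp_apply]
    rw [hLs w hw, exp_add, exp_int_mul_two_pi_mul_I, mul_one]
  have hMper : ∀ (k : ℕ), ∀ w ∈ H, w + k * (2 * Real.pi * I) ∈ H ∧
      L (w + k * (2 * Real.pi * I)) - n * (w + k * (2 * Real.pi * I)) = L w - n * w := by
    intro k
    induction k with
    | zero => intro w hw; simpa using hw
    | succ k ih =>
      intro w hw
      obtain ⟨h1, h2⟩ := ih w hw
      have h3 := hper h1
      have h4 := hshift _ h1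
      have h5 : w + ((k + 1 : ℕ) : ℂ) * (2 * Real.pi * I) =
        w + k * (2 * Real.pi * I) + 2 * Real.pi * I := by push_cast; ring
      rw [h5]
      refine ⟨h4, ?_⟩
      simp only at h3
      rw [h3, ← h2]
      ring
  have hM : ∀ w ∈ H, ∀ w' ∈ H, exp w = exp w' → L w - n * w = L w' - n * w' := by
    intro w hw w' hw' h
    obtain ⟨k, hk⟩ := exp_eq_exp_iff_exists_int.1 h
    obtain ⟨k, rfl | rfl⟩ := k.eq_nat_or_neg
    · rw [hk]
      exact_mod_cast (hMper k w' hw').2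
    · have : w' = w + k * (2 * Real.pi * I) := by rw [hk]; push_cast; ring
      rw [this]
      exact (hMper k w hw).2.symm
  have hlog : ∀ z ∈ ball q r \ {q}, exp (log (z - q)) = z - q := fun z hz ↦
    exp_log (sub_ne_zero.2 hz.2)
  have hlogH : ∀ z ∈ ball q r \ {q}, log (z - q) ∈ H := fun z hz ↦ by
    rw [hmem, hlog z hz]; simpa using hz
  refine ⟨n, fun z ↦ L (log (z - q)) - n * log (z - q), fun z₀ hz₀ ↦ ?_, fun z hz ↦ ?_⟩
  · have hu : z₀ - q ≠ 0 := sub_ne_zero.2 hz₀.2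
    have hcont : ContinuousAt (fun z ↦ log ((z - q) / (z₀ - q)) + log (z₀ - q)) z₀ := by
      refine ContinuousAt.add (ContinuousAt.clog (by fun_prop) ?_) continuousAt_const
      simp [div_self hu]
    have hval : log ((z₀ - q) / (z₀ - q)) + log (z₀ - q) = log (z₀ - q) := by
      simp [div_self hu]
    have hLat : ContinuousAt (fun w ↦ L w - n * w) (log ((z₀ - q) / (z₀ - q)) + log (z₀ - q)) := by
      rw [hval]
      exact (hLc.continuousAt (hHo.mem_nhds (hlogH z₀ hz₀))).sub (by fun_prop)
    have hcomp :=
      ContinuousAt.comp (f := fun z ↦ log ((z - q) / (z₀ - q)) + log (z₀ - q)) hLat hcont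
    refine (hcomp.continuousWithinAt).congr_of_eventuallyEq_of_mem ?_ hz₀
    filter_upwards [self_mem_nhdsWithin] with z hz
    have he : exp (log ((z - q) / (z₀ - q)) + log (z₀ - q)) = z - q := by
      rw [exp_add, exp_log hu, exp_log (div_ne_zero (sub_ne_zero.2 hz.2) hu), div_mul_cancel₀ _ hu]
    refine hM _ (hlogH z hz) _ ?_ ?_
    · rw [hmem, he]; simpa using hz
    · rw [he, hlog z hz]
  · have h1 := hL (hlogH z hz)
    simp only [Function.comp_apply, hlog z hz, add_sub_cancel] at h1
    rw [← h1, ← hlog z hz, ← exp_int_mul, ← exp_add, hlog z hz]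
    congr 1; ring

/-- A nonvanishing function on the plane punctured at finitely many points is, up to a square, a
product of linear factors at some of the punctures. -/
theorem exists_prod_sub_mul_sq (Q : Finset ℂ) (f : ℂ → ℂ) (hf : ContinuousOn f (Q : Set ℂ)ᶜ)
    (h0 : ∀ z ∉ Q, f z ≠ 0) :
    ∃ S ⊆ Q, ∃ g : ℂ → ℂ, ContinuousOn g (Q : Set ℂ)ᶜ ∧
      ∀ z ∉ Q, f z = (∏ q ∈ S, (z - q)) * g z ^ 2 := by
  classical
  induction Q using Finset.induction_on generalizing f with
  | empty =>
    obtain ⟨g, hg, hgf⟩ := exists_continuousOn_pow_eq (g := f) (U := univ) (n := 2)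
      (convex_univ.isSimplyConnected_of_nonempty univ_nonempty) isOpen_univ (by simpa using hf)
      (by rintro ⟨z, -, hz⟩; exact h0 z (by simp) hz) two_ne_zero
    exact ⟨∅, by simp, g, by simpa using hg, fun z _ ↦ by simp [hgf]⟩
  | insert q Q hq ih =>
    have hQ : (Q : Set ℂ)ᶜ ∈ 𝓝 q := Q.finite_toSet.isClosed.isOpen_compl.mem_nhds hq
    obtain ⟨r, hr, hrQ⟩ := Metric.mem_nhds_iff.1 hQ
    have hsub : ball q r \ {q} ⊆ ((insert q Q : Finset ℂ) : Set ℂ)ᶜ := fun z hz ↦ by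
      simpa using ⟨hz.2, hrQ hz.1⟩
    obtain ⟨n, l, hl, hfl⟩ := exists_zpow_mul_exp_of_ball_diff_center hr (hf.mono hsub)
      fun z hz ↦ h0 z (hsub hz)
    let χ : ℂ → ℝ := fun z ↦ max 0 (min 1 (2 - 3 * dist z q / r))
    have hχc : Continuous χ := by fun_prop
    have hχ1 : ∀ z ∈ ball q (r / 3), χ z = 1 := fun z hz ↦ by
      have h1 : 3 * dist z q / r ≤ 1 := by
        rw [div_le_one hr]; rw [mem_ball] at hz; linarith
      simp only [χ]
      rw [min_eq_left (by linarith), max_eq_right zero_le_one]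
    have hχ0 : ∀ z ∉ closedBall q (2 * r / 3), χ z = 0 := fun z hz ↦ by
      have h1 : 2 ≤ 3 * dist z q / r := by
        rw [le_div_iff₀ hr]; rw [mem_closedBall, not_le] at hz; linarith
      simp only [χ]
      rw [max_eq_left]
      exact (min_le_right _ _).trans (by linarith)
    have hopen : IsOpen (ball q r \ {q}) := isOpen_ball.sdiff isClosed_singleton
    have hχl : ContinuousOn (fun z ↦ (χ z : ℂ) * l z) {q}ᶜ := by
      intro z hz
      apply ContinuousAt.continuousWithinAt
      by_cases hzr : z ∈ ball q r
      · exact (continuous_ofReal.comp hχc).continuousAt.mul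
          (hl.continuousAt (hopen.mem_nhds ⟨hzr, hz⟩))
      · have hz' : (closedBall q (2 * r / 3))ᶜ ∈ 𝓝 z := by
          refine isClosed_closedBall.isOpen_compl.mem_nhds fun h ↦ hzr ?_
          rw [mem_closedBall] at h
          rw [mem_ball]; linarith
        refine (continuousAt_const (y := (0 : ℂ))).congr ?_
        filter_upwards [hz'] with w hw
        simp [hχ0 w hw]
    let f' : ℂ → ℂ := Function.update
      (fun z ↦ f z * (z - q) ^ (-n) * exp (-(χ z * l z))) q 1
    have hf'q : ∀ z ∈ ball q (r / 3), f' z = 1 := fun z hz ↦ by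
      by_cases hzq : z = q
      · simp [f', hzq]
      · have hz' : z ∈ ball q r \ {q} := ⟨ball_subset_ball (by linarith) hz, hzq⟩
        have h1 : (z - q) ^ n ≠ 0 := zpow_ne_zero _ (sub_ne_zero.2 hzq)
        simp only [f', Function.update_of_ne hzq]
        rw [hfl z hz', hχ1 z hz, zpow_neg, exp_neg]
        have := exp_ne_zero (l z)
        simp only [ofReal_one, one_mul]
        field_simp
    have hf'ne : ∀ z, z ≠ q → f' z = f z * (z - q) ^ (-n) * exp (-(χ z * l z)) := fun z hz ↦ by
      simp only [f', Function.update_of_ne hz]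
    have hf'c : ContinuousOn f' (Q : Set ℂ)ᶜ := by
      intro z hz
      apply ContinuousAt.continuousWithinAt
      by_cases hzq : z = q
      · refine (continuousAt_const (y := (1 : ℂ))).congr ?_
        rw [hzq]
        filter_upwards [ball_mem_nhds q (by linarith : 0 < r / 3)] with w hw
        rw [hf'q w hw]
      · have hins : z ∈ ((insert q Q : Finset ℂ) : Set ℂ)ᶜ := by simpa using ⟨hzq, hz⟩
        have h1 : ContinuousAt f z := hf.continuousAt
          ((insert q Q).finite_toSet.isClosed.isOpen_compl.mem_nhds hins)
        have h2 : ContinuousAt (fun z ↦ (χ z : ℂ) * l z) z :=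
          hχl.continuousAt (isOpen_compl_singleton.mem_nhds hzq)
        have h3 : ContinuousAt (fun z ↦ (z - q) ^ (-n)) z :=
          ContinuousAt.zpow₀ (by fun_prop) _ (.inl (sub_ne_zero.2 hzq))
        refine ((h1.mul h3).mul h2.neg.cexp).congr ?_
        filter_upwards [isOpen_compl_singleton.mem_nhds hzq] with w hw
        rw [hf'ne w hw]
        rfl
    obtain ⟨S, hSQ, g, hg, hfg⟩ := ih f' hf'c fun z hz ↦ by
      by_cases hzq : z = q
      · simp [f', hzq]
      · rw [hf'ne z hzq]
        have := h0 z (by simpa using ⟨hzq, hz⟩)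
        have := zpow_ne_zero (-n) (sub_ne_zero.2 hzq)
        have := exp_ne_zero (-(χ z * l z))
        positivity
    have hqS : q ∉ S := fun h ↦ hq (hSQ h)
    have hkey : ∀ z ∉ insert q Q, f z =
        (z - q) ^ n * (∏ q ∈ S, (z - q)) * (g z * exp (χ z * l z / 2)) ^ 2 := fun z hz ↦ by
      rw [Finset.mem_insert, not_or] at hz
      have h1 := hf'ne z hz.1
      rw [hfg z hz.2, zpow_neg, exp_neg] at h1
      have h2 : exp (χ z * l z / 2) ^ 2 = exp (χ z * l z) := by
        rw [← exp_nat_mul]; congr 1; push_cast; ring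
      have h3 : (z - q) ^ n ≠ 0 := zpow_ne_zero _ (sub_ne_zero.2 hz.1)
      have h4 := exp_ne_zero (χ z * l z)
      rw [mul_pow, h2, ← mul_assoc, mul_assoc ((z - q) ^ n), h1]
      field_simp
    have hGc : ∀ m : ℤ, ContinuousOn (fun z ↦ (z - q) ^ m * (g z * exp (χ z * l z / 2)))
        ((insert q Q : Finset ℂ) : Set ℂ)ᶜ := fun m ↦ by
      have hs1 : ((insert q Q : Finset ℂ) : Set ℂ)ᶜ ⊆ (Q : Set ℂ)ᶜ :=
        compl_subset_compl.2 (by simp)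
      have hs2 : ((insert q Q : Finset ℂ) : Set ℂ)ᶜ ⊆ {q}ᶜ :=
        compl_subset_compl.2 (by simp)
      refine ContinuousOn.mul (ContinuousOn.zpow₀ (by fun_prop) _ fun z hz ↦ .inl ?_)
        ((hg.mono hs1).mul ((hχl.mono hs2).div_const 2).cexp)
      exact sub_ne_zero.2 (hs2 hz)
    obtain ⟨m, rfl | rfl⟩ := n.even_or_odd'
    · refine ⟨S, hSQ.trans (Finset.subset_insert _ _), _, hGc m, fun z hz ↦ ?_⟩
      have h : (z - q) ^ (2 * m) = ((z - q) ^ m) ^ 2 := by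
        rw [mul_comm, zpow_mul]; norm_cast
      rw [hkey z hz, h]
      ring
    · refine ⟨insert q S, Finset.insert_subset_insert _ hSQ, _, hGc m, fun z hz ↦ ?_⟩
      have hzq : z - q ≠ 0 := sub_ne_zero.2 fun h ↦ hz (by simp [h])
      have h : (z - q) ^ (2 * m + 1) = ((z - q) ^ m) ^ 2 * (z - q) := by
        rw [zpow_add₀ hzq, zpow_one, mul_comm 2, zpow_mul]; norm_cast
      rw [hkey z hz, h, Finset.prod_insert hqS]
      ring

theorem IsCoveringMap.eqOn_preimage_of_sq_eq {E X : Type*} [TopologicalSpace E]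
    [TopologicalSpace X] {p : E → X} (hp : IsCoveringMap p) {U : Set X} (hU : IsPathConnected U)
    {x₀ : X} (hx₀ : x₀ ∈ U) {u v : E → ℂ} (hu : ContinuousOn u (p ⁻¹' U))
    (hv : ContinuousOn v (p ⁻¹' U)) (huv : ∀ y, u y ^ 2 = v y ^ 2) (hv0 : ∀ y, v y ≠ 0)
    (h : ∀ y, p y = x₀ → u y = v y) : EqOn u v (p ⁻¹' U) := by
  intro y hy
  obtain ⟨γ, hγ⟩ := hU.joinedIn _ hy _ hx₀
  obtain ⟨Γ, hΓ, hΓ0⟩ := hp.exists_path_lifts γ.toContinuousMap y (by simp)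
  have hmaps : MapsTo Γ univ (p ⁻¹' U) := fun t _ ↦ by
    have := congrFun hΓ t
    simp only [Function.comp_apply] at this
    rw [mem_preimage, this]
    exact hγ t
  have h1 : p (Γ 1) = x₀ := by
    have := congrFun hΓ 1
    simpa using this
  have key := isPreconnected_univ.eq_of_sq_eq (f := u ∘ Γ) (g := v ∘ Γ)
    (hu.comp Γ.continuous.continuousOn hmaps) (hv.comp Γ.continuous.continuousOn hmaps)
    (fun t _ ↦ huv _) (fun _ ↦ hv0 _) (mem_univ 1) (h _ h1) (mem_univ 0)
  simpa [hΓ0] using key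

theorem exists_finset_interlacing (A : Finset ℝ) (c : ℝ) (hc : ∀ a ∈ A, a < c) :
    ∃ B : Finset ℝ, B.card = A.card + 1 ∧ (∀ x ∈ B, x < c ∧ x ∉ A) ∧
      ∀ x ∈ B, ∀ y ∈ B, x < y → ∃ a ∈ A, x < a ∧ a < y := by
  induction A using Finset.induction_on_max generalizing c with
  | empty => exact ⟨{c - 1}, by simp⟩
  | insert a A ha ih =>
    obtain ⟨B, hB, hBA, hsep⟩ := ih a ha
    have hac : a < c := hc a (by simp)
    have hb : (a + c) / 2 ∉ B := fun h ↦ by linarith [(hBA _ h).1]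
    refine ⟨insert ((a + c) / 2) B, ?_, ?_, ?_⟩
    · rw [Finset.card_insert_of_notMem hb, hB,
        Finset.card_insert_of_notMem fun h ↦ (ha a h).false]
    · intro x hx
      rcases Finset.mem_insert.1 hx with rfl | hx
      · refine ⟨by linarith, fun h ↦ ?_⟩
        rcases Finset.mem_insert.1 h with h | h
        · linarith
        · linarith [ha _ h]
      · have := hBA x hx
        refine ⟨this.1.trans hac, fun h ↦ ?_⟩
        rcases Finset.mem_insert.1 h with h | h
        · exact this.1.ne h
        · exact this.2 h
    · intro x hx y hy hxy
      rcases Finset.mem_insert.1 hx with rfl | hx <;> rcases Finset.mem_insert.1 hy with rfl | hy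
      · exact absurd hxy (lt_irrefl _)
      · linarith [(hBA y hy).1]
      · exact ⟨a, by simp, (hBA x hx).1, by linarith⟩
      · obtain ⟨b, hb, h⟩ := hsep x hx y hy hxy
        exact ⟨b, Finset.mem_insert_of_mem hb, h⟩

/-- The complement of the downward (`s = 1`) or upward (`s = -1`) vertical rays from `P`. -/
def verticalSlit (P : Finset ℂ) (s : ℝ) : Set ℂ :=
  {z | ∀ q ∈ P, z.re = q.re → s * q.im < s * z.im}

theorem isOpen_verticalSlit (P : Finset ℂ) (s : ℝ) : IsOpen (verticalSlit P s) := by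
  have : verticalSlit P s = ⋂ q ∈ P, ({z | z.re ≠ q.re} ∪ {z | s * q.im < s * z.im}) := by
    ext z
    simp [verticalSlit, imp_iff_not_or]
  rw [this]
  refine isOpen_biInter_finset fun q _ ↦ IsOpen.union ?_ ?_
  · exact isOpen_ne_fun continuous_re continuous_const
  · exact isOpen_lt continuous_const (by fun_prop)

theorem verticalSlit_subset (P : Finset ℂ) (s : ℝ) : verticalSlit P s ⊆ (P : Set ℂ)ᶜ :=
  fun z hz hzP ↦ (hz z hzP rfl).false

theorem mem_verticalSlit_of_re {P : Finset ℂ} (s : ℝ) {z : ℂ} (h : z.re ∉ P.image re) :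
    z ∈ verticalSlit P s :=
  fun q hq hzq ↦ absurd (Finset.mem_image.2 ⟨q, hq, hzq.symm⟩) h

theorem isPathConnected_verticalSlit (P : Finset ℂ) {s : ℝ} (hs : s ≠ 0) :
    IsPathConnected (verticalSlit P s) := by
  obtain ⟨x, hx⟩ := Infinite.exists_notMem_finset (P.image re)
  have hxP : ∀ z : ℂ, z.re = x → z ∈ verticalSlit P s := fun z hz ↦
    mem_verticalSlit_of_re s (hz ▸ hx)
  refine ⟨x, hxP _ (ofReal_re x), fun {z} hz ↦ ?_⟩
  obtain ⟨k, hk⟩ : ∃ k, ∀ x ∈ (insert z P).image fun q ↦ s * q.im, x < k := by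
    obtain ⟨k, hk⟩ := ((insert z P).image fun q ↦ s * q.im).exists_le
    exact ⟨k + 1, fun x hx ↦ (hk x hx).trans_lt (lt_add_one k)⟩
  have hkz : s * z.im < k := hk _ (Finset.mem_image_of_mem _ (by simp))
  have hkP : ∀ q ∈ P, s * q.im < k := fun q hq ↦
    hk _ (Finset.mem_image_of_mem (fun q : ℂ ↦ s * q.im) (by simp [hq]))
  have hsk : s * (k / s) = k := by field_simp
  have hhigh : ∀ w : ℂ, w.im = k / s → w ∈ verticalSlit P s := fun w hw q hq _ ↦ by
    rw [hw, hsk]; exact hkP q hq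
  refine JoinedIn.trans (y := ⟨x, k / s⟩) (.of_segment_subset ?_)
    (JoinedIn.trans (y := ⟨z.re, k / s⟩) (.of_segment_subset ?_) (.of_segment_subset ?_))
  · rintro w ⟨a, b, -, -, hab, rfl⟩
    apply hxP
    simp [← add_mul, hab]
  · rintro w ⟨a, b, -, -, hab, rfl⟩
    apply hhigh
    simp [← add_mul, hab]
  · rintro w ⟨a, b, ha, hb, hab, rfl⟩ q hq hre
    have hre' : z.re = q.re := by
      rw [← hre]; simp [← add_mul, hab]
    have h1 := hz q hq hre'
    have h2 := hkP q hq
    have h3 : s * (a • (⟨z.re, k / s⟩ : ℂ) + b • z).im = a * k + b * (s * z.im) := by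
      simp; field_simp
    rw [h3]
    obtain rfl : a = 1 - b := by linarith
    rcases hb.eq_or_lt with rfl | hb
    · simpa using h2
    · nlinarith

/-- A covering of a punctured plane is injective on connected sets lying over the complement of the
vertical lines through the punctures. -/
theorem IsCoveringMap.eq_of_isPreconnected_of_re_notMem {E : Type*} [TopologicalSpace E]
    {P : Finset ℂ} {p : E → ((P : Set ℂ)ᶜ : Set ℂ)} (hp : IsCoveringMap p) {K : Set E}
    (hK : IsPreconnected K) (hKP : ∀ y ∈ K, (p y : ℂ).re ∉ P.image re) {y y' : E} (hy : y ∈ K)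
    (hy' : y' ∈ K) (h : p y = p y') : y = y' := by
  set C : Set ℝ := connectedComponentIn ((P.image re : Finset ℝ) : Set ℝ)ᶜ (p y : ℂ).re with hC
  have hCo : IsOpen C :=
    (P.image re).finite_toSet.isClosed.isOpen_compl.connectedComponentIn
  have hCA : C ⊆ ((P.image re : Finset ℝ) : Set ℝ)ᶜ := connectedComponentIn_subset _ _
  have hSo : IsOpen (re ⁻¹' C) := hCo.preimage continuous_re
  have hSc : Convex ℝ (re ⁻¹' C) :=
    (isPreconnected_connectedComponentIn.ordConnected.convex).linear_preimage reLm
  have hSP : re ⁻¹' C ⊆ (P : Set ℂ)ᶜ := fun z hz hzP ↦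
    hCA hz (Finset.mem_image_of_mem _ hzP)
  have hKC : ∀ k ∈ K, (p k : ℂ) ∈ re ⁻¹' C := fun k hk ↦ by
    have hcont : Continuous fun y ↦ (p y : ℂ).re :=
      continuous_re.comp (continuous_subtype_val.comp hp.continuous)
    refine (hK.image _ hcont.continuousOn).subset_connectedComponentIn ⟨y, hy, rfl⟩ ?_
      ⟨k, hk, rfl⟩
    rintro _ ⟨k, hk, rfl⟩
    exact hKP k hk
  have := hSc.contractibleSpace ⟨_, hKC y hy⟩
  have := hSo.locallyPathConnectedSpace
  obtain ⟨σ, ⟨hσy, hσ⟩, -⟩ := hp.existsUnique_continuousMap_lifts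
    (⟨inclusion hSP, continuous_inclusion hSP⟩ : C(re ⁻¹' C, ((P : Set ℂ)ᶜ : Set ℂ)))
    (a₀ := ⟨p y, hKC y hy⟩) (e₀ := y) (by ext; rfl)
  let τ : K → E := fun k ↦ σ ⟨p k, hKC k k.2⟩
  have hτ : Continuous τ := σ.continuous.comp
    ((continuous_subtype_val.comp (hp.continuous.comp continuous_subtype_val)).subtype_mk _)
  have : PreconnectedSpace K := isPreconnected_iff_preconnectedSpace.1 hK
  have key := hp.eq_of_comp_eq (g₁ := τ) (g₂ := Subtype.val) hτ continuous_subtype_val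
    (funext fun k ↦ congrFun hσ ⟨p k, hKC k k.2⟩) ⟨y, hy⟩ hσy
  have h2 := congrFun key ⟨y', hy'⟩
  have h3 : τ ⟨y', hy'⟩ = τ ⟨y, hy⟩ := congrArg σ (Subtype.ext (by simp [h]))
  rw [key] at h3
  exact h3.symm

/-- If nonvanishing functions on a covering of degree `d` of a punctured plane fall into finitely
many classes modulo squares, the number of classes bounds the number of punctures. -/
theorem IsCoveringMap.two_pow_le_of_sq_classes {E : Type*} [TopologicalSpace E]
    [LocallyConnectedSpace E] {P : Finset ℂ} (hP : InjOn re (P : Set ℂ))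
    {p : E → ((P : Set ℂ)ᶜ : Set ℂ)} (hp : IsCoveringMap p) {d : ℕ} (hd : 1 ≤ d)
    (hcard : ∀ x, Nat.card (p ⁻¹' {x}) = d) {κ : Type*} [Finite κ] (cls : (E → ℂ) → κ)
    (hcls : ∀ f f' : E → ℂ, Continuous f → Continuous f' → (∀ y, f y ≠ 0) → (∀ y, f' y ≠ 0) →
      cls f = cls f' → ∃ g : E → ℂ, Continuous g ∧ ∀ y, f y = f' y * g y ^ 2) :
    2 * 2 ^ ((P.card + 1) * d) ≤ Nat.card κ * (2 ^ d * 2 ^ d) := by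
  classical
  have hfin : ∀ x, Finite (p ⁻¹' {x}) := fun x ↦
    Nat.finite_of_card_ne_zero (by rw [hcard x]; omega)
  set A : Finset ℝ := P.image re with hA
  obtain ⟨B, hBcard, hBA, hsep⟩ : ∃ B : Finset ℝ, B.card = P.card + 1 ∧ (∀ x ∈ B, x ∉ A) ∧
      ∀ x ∈ B, ∀ y ∈ B, x < y → ∃ a ∈ A, x < a ∧ a < y := by
    obtain ⟨c, hc⟩ := A.exists_le
    obtain ⟨B, h1, h2, h3⟩ := exists_finset_interlacing A (c + 1)
      fun a ha ↦ (hc a ha).trans_lt (lt_add_one c)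
    exact ⟨B, by rw [h1, hA, Finset.card_image_of_injOn hP], fun x hx ↦ (h2 x hx).2, h3⟩
  have hBP : ∀ x ∈ B, (x : ℂ) ∈ (P : Set ℂ)ᶜ := fun x hx hxP ↦
    hBA x hx (Finset.mem_image.2 ⟨x, hxP, ofReal_re x⟩)
  let pt : B → ((P : Set ℂ)ᶜ : Set ℂ) := fun x ↦ ⟨(x : ℝ), hBP x x.2⟩
  let J := Σ x : B, p ⁻¹' {pt x}
  have hJ : Nat.card J = (P.card + 1) * d := by
    rw [Nat.card_sigma]
    simp [hcard, hBcard]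
  have : Finite J := inferInstance
  set W : Set E := {y | (p y : ℂ).re ∉ A} with hW
  have hre : Continuous fun y ↦ (p y : ℂ).re :=
    continuous_re.comp (continuous_subtype_val.comp hp.continuous)
  have hWo : IsOpen W := A.finite_toSet.isClosed.isOpen_compl.preimage hre
  have hJW : ∀ j : J, (j.2 : E) ∈ W := fun j ↦ by
    have h : p j.2 = pt j.1 := j.2.2
    rw [hW, mem_ofPred_eq, h]
    simpa [pt] using hBA _ j.1.2
  let M : Set J → Set E := fun T ↦ ⋃ j ∈ T, connectedComponentIn W j.2
  have hMo : ∀ T, IsOpen (M T) := fun T ↦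
    isOpen_biUnion fun j _ ↦ hWo.connectedComponentIn
  have hfr : ∀ T, ∀ y ∈ frontier (M T), y ∉ W := fun T y hy hyW ↦ by
    obtain ⟨w, hw, hwM⟩ := mem_closure_iff.1 hy.1 _ hWo.connectedComponentIn
      (mem_connectedComponentIn hyW)
    obtain ⟨j, hj, hwj⟩ := mem_iUnion₂.1 hwM
    refine hy.2 ?_
    rw [(hMo T).interior_eq]
    refine mem_iUnion₂.2 ⟨j, hj, ?_⟩
    rw [connectedComponentIn_eq hwj, ← connectedComponentIn_eq hw]
    exact mem_connectedComponentIn hyW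
  have hcomp : ∀ j j' : J, (j'.2 : E) ∈ connectedComponentIn W j.2 → j' = j := by
    intro j j' h
    have hKW : ∀ y ∈ connectedComponentIn W (j.2 : E), (p y : ℂ).re ∉ A := fun y hy ↦
      connectedComponentIn_subset _ _ hy
    have hj : p j.2 = pt j.1 := j.2.2
    have hj' : p j'.2 = pt j'.1 := j'.2.2
    have hjr : (p j.2 : ℂ).re = j.1 := by rw [hj]; exact ofReal_re _
    have hjr' : (p j'.2 : ℂ).re = j'.1 := by rw [hj']; exact ofReal_re _
    have hself := mem_connectedComponentIn (hJW j)
    have hoc := ((isPreconnected_connectedComponentIn (F := W) (x := (j.2 : E))).image _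
      hre.continuousOn).ordConnected
    have hnot : ∀ a ∈ A, a ∉ (fun y ↦ (p y : ℂ).re) '' connectedComponentIn W (j.2 : E) := by
      rintro _ ha ⟨y, hy, rfl⟩
      exact hKW y hy ha
    have h1 : j'.1 = j.1 := by
      rcases lt_trichotomy (j'.1 : ℝ) j.1 with hlt | heq | hlt
      · obtain ⟨a, ha, h1, h2⟩ := hsep _ j'.1.2 _ j.1.2 hlt
        exact absurd (hoc.out ⟨_, h, hjr'⟩ ⟨_, hself, hjr⟩ ⟨h1.le, h2.le⟩) (hnot a ha)
      · exact Subtype.ext heq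
      · obtain ⟨a, ha, h1, h2⟩ := hsep _ j.1.2 _ j'.1.2 hlt
        exact absurd (hoc.out ⟨_, hself, hjr⟩ ⟨_, h, hjr'⟩ ⟨h1.le, h2.le⟩) (hnot a ha)
    have h2 : (j'.2 : E) = j.2 := hp.eq_of_isPreconnected_of_re_notMem
      isPreconnected_connectedComponentIn hKW h hself (by rw [hj, hj', h1])
    obtain ⟨x, y, hy⟩ := j
    obtain ⟨x', y', hy'⟩ := j'
    obtain rfl : x' = x := h1
    obtain rfl : y' = y := h2
    rfl
  have hMJ : ∀ T (j : J), (j.2 : E) ∈ M T ↔ j ∈ T := fun T j ↦ by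
    refine ⟨fun h ↦ ?_, fun h ↦ mem_iUnion₂.2 ⟨j, h, mem_connectedComponentIn (hJW j)⟩⟩
    obtain ⟨j', hj', h⟩ := mem_iUnion₂.1 h
    rwa [hcomp j' j h]
  let U : Set ((P : Set ℂ)ᶜ : Set ℂ) := Subtype.val ⁻¹' verticalSlit P 1
  let V : Set ((P : Set ℂ)ᶜ : Set ℂ) := Subtype.val ⁻¹' verticalSlit P (-1)
  have hUV : Disjoint Vᶜ Uᶜ := by
    rw [Set.disjoint_left]
    intro z hzV hzU
    simp only [U, V, verticalSlit, mem_compl_iff, mem_preimage, mem_ofPred_eq, not_forall,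
      not_lt] at hzU hzV
    obtain ⟨q, hq, h1, h2⟩ := hzU
    obtain ⟨q', hq', h1', h2'⟩ := hzV
    obtain rfl := hP hq hq' (h1.symm.trans h1')
    refine z.2 ?_
    rw [Complex.ext h1 (by linarith : (z : ℂ).im = q.im)]
    exact hq
  obtain ⟨ρ, hρV, hρU, -⟩ := exists_continuous_zero_one_of_isClosed
    ((isOpen_verticalSlit P (-1)).preimage continuous_subtype_val).isClosed_compl
    ((isOpen_verticalSlit P 1).preimage continuous_subtype_val).isClosed_compl hUV
  have hWUV : ∀ y, y ∉ W → p y ∉ U ∨ p y ∉ V := fun y hy ↦ by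
    simp only [hW, hA, mem_ofPred_eq, Finset.mem_image, not_not] at hy
    obtain ⟨q, hq, hqy⟩ := hy
    by_contra! h
    have h1 := h.1 q hq hqy.symm
    have h2 := h.2 q hq hqy.symm
    linarith
  let r : E → ℂ := fun y ↦ (ρ (p y) : ℂ)
  have hr : Continuous r := continuous_ofReal.comp (ρ.continuous.comp hp.continuous)
  let f : Set J → E → ℂ := fun T ↦ (M T).piecewise (fun y ↦ exp (2 * Real.pi * I * r y)) 1
  let a : Set J → E → ℂ := fun T ↦ (M T).piecewise r 0
  let b : Set J → E → ℂ := fun T ↦ (M T).piecewise (fun y ↦ r y - 1) 0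
  have hfc : ∀ T, Continuous (f T) := fun T ↦ by
    refine Continuous.piecewise (fun y hy ↦ ?_) (by fun_prop) continuous_const
    rcases hWUV y (hfr T y hy) with h | h
    · have : r y = 1 := by simp [r, hρU h]
      simp [this, exp_two_pi_mul_I]
    · have : r y = 0 := by simp [r, hρV h]
      simp [this]
  have hac : ∀ T, ContinuousOn (a T) (p ⁻¹' U) := fun T ↦ by
    refine ContinuousOn.piecewise (fun y hy ↦ ?_) hr.continuousOn continuousOn_const
    have h : p y ∉ V := (hWUV y (hfr T y hy.2)).resolve_left (not_not.2 hy.1)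
    simp [r, hρV h]
  have hbc : ∀ T, ContinuousOn (b T) (p ⁻¹' V) := fun T ↦ by
    refine ContinuousOn.piecewise (fun y hy ↦ ?_) (by fun_prop) continuousOn_const
    have h : p y ∉ U := (hWUV y (hfr T y hy.2)).resolve_right (not_not.2 hy.1)
    simp [r, hρU h]
  have hfa : ∀ T y, f T y = exp (2 * Real.pi * I * a T y) := fun T y ↦ by
    by_cases hy : y ∈ M T <;> simp [f, a, hy]
  have hfb : ∀ T y, f T y = exp (2 * Real.pi * I * b T y) := fun T y ↦ by
    by_cases hy : y ∈ M T
    · simp [f, b, hy, mul_sub, exp_sub, exp_two_pi_mul_I]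
    · simp [f, b, hy]
  have hab : ∀ T y, a T y = b T y + if y ∈ M T then 1 else 0 := fun T y ↦ by
    by_cases hy : y ∈ M T <;> simp [a, b, hy]
  have hf0 : ∀ T y, f T y ≠ 0 := fun T y ↦ by rw [hfa]; exact exp_ne_zero _
  have hsq : ∀ c : Set J → E → ℂ, (∀ T y, f T y = exp (2 * Real.pi * I * c T y)) →
      ∀ (T T' : Set J) (G : E → ℂ), (∀ y, f T y = f T' y * G y ^ 2) →
      ∀ y, (G y * exp (-(Real.pi * I * (c T y - c T' y)))) ^ 2 = 1 := by
    intro c hc T T' G hG y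
    have h1 := hG y
    rw [hc, hc] at h1
    have h2 : exp (-(Real.pi * I * (c T y - c T' y))) ^ 2 =
        exp (2 * Real.pi * I * c T' y) / exp (2 * Real.pi * I * c T y) := by
      rw [← exp_sub, ← exp_nat_mul]; congr 1; push_cast; ring
    rw [mul_pow, h2, h1]
    have := exp_ne_zero (2 * Real.pi * I * c T' y)
    have : G y ≠ 0 := fun h ↦ exp_ne_zero (2 * Real.pi * I * c T y) (by simp [h1, h])
    field_simp
  obtain ⟨x₀, hx₀⟩ : B.Nonempty := by rw [← Finset.card_pos]; omega
  have hx₀U : ∀ s, (x₀ : ℂ) ∈ verticalSlit P s := fun s ↦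
    mem_verticalSlit_of_re s (by rw [ofReal_re]; exact hBA x₀ hx₀)
  let Φ := p ⁻¹' {pt ⟨x₀, hx₀⟩}
  have hdet : ∀ c : Set J → E → ℂ, (∀ T y, f T y = exp (2 * Real.pi * I * c T y)) →
      ∀ s : ℝ, s ≠ 0 → (∀ T, ContinuousOn (c T) (p ⁻¹' (Subtype.val ⁻¹' verticalSlit P s))) →
      ∀ (T₁ T₂ T' : Set J) (G₁ G₂ : E → ℂ), Continuous G₁ → Continuous G₂ →
        (∀ y, f T₁ y = f T' y * G₁ y ^ 2) →
      (∀ y, f T₂ y = f T' y * G₂ y ^ 2) →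
      (∀ y : Φ, G₁ y * exp (-(Real.pi * I * (c T₁ y - c T' y))) = 1 ↔
        G₂ y * exp (-(Real.pi * I * (c T₂ y - c T' y))) = 1) →
      ∀ y, (p y : ℂ) ∈ verticalSlit P s →
        G₁ y * exp (-(Real.pi * I * (c T₁ y - c T' y))) =
        G₂ y * exp (-(Real.pi * I * (c T₂ y - c T' y))) := by
    intro c hc s hs hcc T₁ T₂ T' G₁ G₂ hG₁ hG₂ h₁ h₂ hiff y hy
    have hsq₁ := hsq c hc T₁ T' G₁ h₁
    have hsq₂ := hsq c hc T₂ T' G₂ h₂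
    have hc₁ := hcc T₁
    have hc₂ := hcc T₂
    have hc' := hcc T'
    refine hp.eqOn_preimage_of_sq_eq
      ((isPathConnected_verticalSlit P hs).preimage_coe (verticalSlit_subset P s))
      (x₀ := pt ⟨x₀, hx₀⟩) (hx₀U s)
      (u := fun y ↦ G₁ y * exp (-(Real.pi * I * (c T₁ y - c T' y))))
      (v := fun y ↦ G₂ y * exp (-(Real.pi * I * (c T₂ y - c T' y))))
      (by fun_prop) (by fun_prop) (fun y ↦ (hsq₁ y).trans (hsq₂ y).symm)
      (fun y h ↦ ?_) (fun y hy ↦ ?_) hy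
    · have := hsq₂ y
      rw [h] at this
      norm_num at this
    · have hi := hiff ⟨y, hy⟩
      rcases sq_eq_one_iff.1 (hsq₁ y) with h | h <;>
        rcases sq_eq_one_iff.1 (hsq₂ y) with h' | h' <;>
        simp only [h, h'] at hi ⊢ <;> norm_num at hi
  have hexp : ∀ (c : Prop) [Decidable c], exp (Real.pi * I * if c then 1 else 0) =
      if c then -1 else 1 := fun c _ ↦ by
    split_ifs <;> simp
  have hratio : ∀ (T T' : Set J) (z : ℂ) (y : E),
      z * exp (-(Real.pi * I * (a T y - a T' y))) =
        z * exp (-(Real.pi * I * (b T y - b T' y))) * (if y ∈ M T then -1 else 1) *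
          (if y ∈ M T' then -1 else 1) := fun T T' z y ↦ by
    have h : (if y ∈ M T then (-1 : ℂ) else 1) = (if y ∈ M T then (-1 : ℂ) else 1)⁻¹ := by
      split_ifs <;> norm_num
    rw [h, ← hexp, ← hexp, ← exp_neg, mul_assoc z, mul_assoc z, ← exp_add, ← exp_add, hab, hab]
    congr 2
    ring
  let rep : κ → Set J := fun k ↦ if h : ∃ T, cls (f T) = k then h.choose else ∅
  have hrep : ∀ T, cls (f T) = cls (f (rep (cls (f T)))) := fun T ↦ by
    have h : ∃ T', cls (f T') = cls (f T) := ⟨T, rfl⟩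
    simp only [rep, dif_pos h]
    exact h.choose_spec.symm
  choose g hgc hg using fun T ↦ hcls _ _ (hfc T) (hfc _) (hf0 T) (hf0 _) (hrep T)
  let G : ℤˣ × Set J → E → ℂ := fun x y ↦ ((x.1 : ℤ) : ℂ) * g x.2 y
  have hGc : ∀ x, Continuous (G x) := fun x ↦ continuous_const.mul (hgc x.2)
  have hG : ∀ x y, f x.2 y = f (rep (cls (f x.2))) y * G x y ^ 2 := fun x y ↦ by
    have : (((x.1 : ℤ) : ℂ)) ^ 2 = 1 := by
      rcases Int.units_eq_one_or x.1 with h | h <;> simp [h]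
    rw [mul_pow, this, one_mul]
    exact hg x.2 y
  let Ψ : ℤˣ × Set J → κ × Set Φ × Set Φ := fun x ↦ (cls (f x.2),
    {y : Φ | G x y * exp (-(Real.pi * I * (a x.2 y - a (rep (cls (f x.2))) y))) = 1},
    {y : Φ | G x y * exp (-(Real.pi * I * (b x.2 y - b (rep (cls (f x.2))) y))) = 1})
  have hΨ : Function.Injective Ψ := by
    intro x x' h
    obtain ⟨h1, h2, h3⟩ : _ ∧ _ ∧ _ := by simpa only [Ψ, Prod.mk.injEq] using h
    have hG' := hG x'
    rw [← h1] at h2 h3 hG'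
    have hu := hdet a hfa 1 one_ne_zero hac x.2 x'.2 _ (G x) (G x') (hGc x) (hGc x') (hG x) hG'
      fun y ↦ Set.ext_iff.1 h2 y
    have hv := hdet b hfb (-1) (by norm_num) hbc x.2 x'.2 _ (G x) (G x') (hGc x) (hGc x') (hG x)
      hG' fun y ↦ Set.ext_iff.1 h3 y
    have hT : x.2 = x'.2 := by
      ext j
      have hj : (p j.2 : ℂ).re ∉ P.image re := hJW j
      have hu := hu j.2 (mem_verticalSlit_of_re 1 hj)
      have hv := hv j.2 (mem_verticalSlit_of_re (-1) hj)
      have hv0 := hsq b hfb _ _ _ hG' j.2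
      rw [hratio, hratio, hv] at hu
      rw [← hMJ, ← hMJ]
      set w := G x' j.2 * exp (-(Real.pi * I * (b x'.2 j.2 - b (rep (cls (f x.2))) j.2)))
      have hw : w ≠ 0 := fun h ↦ by norm_num [h] at hv0
      by_cases h1 : (j.2 : E) ∈ M x.2 <;> by_cases h2 : (j.2 : E) ∈ M x'.2 <;>
        by_cases h3 : (j.2 : E) ∈ M (rep (cls (f x.2))) <;>
        simp [h1, h2, h3, neg_eq_self, self_eq_neg, hw] at hu ⊢
    refine Prod.ext ?_ hT
    obtain ⟨y₀⟩ : Nonempty Φ := (Nat.card_pos_iff.1 (by rw [hcard]; omega)).1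
    have hu := hu y₀ (by rw [show p y₀ = pt ⟨x₀, hx₀⟩ from y₀.2]; exact hx₀U 1)
    rw [← hT] at hu
    have hg0 : g x.2 y₀ ≠ 0 := fun h ↦ hf0 x.2 y₀ (by rw [hg]; simp [h])
    have hs := mul_right_cancel₀ (exp_ne_zero _) hu
    simp only [G, ← hT] at hs
    exact Units.ext (by exact_mod_cast mul_right_cancel₀ hg0 hs)
  have hle := Nat.card_le_card_of_injective Ψ hΨ
  have hset : ∀ (α : Type _) [Finite α], Nat.card (Set α) = 2 ^ Nat.card α := fun α _ ↦ by
    have := Fintype.ofFinite α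
    rw [Nat.card_eq_fintype_card, Nat.card_eq_fintype_card, Fintype.card_set]
  rw [Nat.card_prod, Nat.card_prod, Nat.card_prod, hset, hset, hJ, hcard,
    Nat.card_eq_fintype_card (α := ℤˣ), Fintype.card_units_int] at hle
  exact hle

theorem nonempty_compl_singleton_homeomorph_complex (a : Sphere2) :
    Nonempty (({a}ᶜ : Set Sphere2) ≃ₜ ℂ) := by
  have : Fact (Module.finrank ℝ (EuclideanSpace ℝ (Fin 3)) = 2 + 1) := ⟨by simp⟩
  let s := stereographic' 2 a
  exact ⟨(Homeomorph.setCongr (stereographic'_source a).symm).trans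
    (s.toHomeomorphSourceTarget.trans
      ((Homeomorph.setCongr (stereographic'_target a)).trans
        ((Homeomorph.Set.univ _).trans orthonormalBasisOneI.repr.toHomeomorph.symm)))⟩

theorem exists_homeomorph_injOn_re {P : Set ℂ} (hP : P.Finite) :
    ∃ s : ℂ ≃ₜ ℂ, InjOn (fun z ↦ (s z).re) P := by
  obtain ⟨t, ht⟩ := (((hP.prod hP).image fun x : ℂ × ℂ ↦
    -((x.1.re - x.2.re) / (x.1.im - x.2.im))).infinite_compl).nonempty
  refine ⟨⟨⟨fun z ↦ ⟨z.re + t * z.im, z.im⟩, fun z ↦ ⟨z.re - t * z.im, z.im⟩, fun z ↦ by simp,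
    fun z ↦ by simp⟩, ?_, ?_⟩, fun z hz w hw h ↦ ?_⟩
  · exact equivRealProdCLM.symm.continuous.comp
      (by fun_prop : Continuous fun z : ℂ ↦ (z.re + t * z.im, z.im))
  · exact equivRealProdCLM.symm.continuous.comp
      (by fun_prop : Continuous fun z : ℂ ↦ (z.re - t * z.im, z.im))
  · have h : z.re + t * z.im = w.re + t * w.im := h
    have him : z.im = w.im := by
      by_contra hne
      refine ht ⟨(z, w), ⟨hz, hw⟩, ?_⟩
      have : z.im - w.im ≠ 0 := sub_ne_zero.2 hne
      simp only
      field_simp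
      linarith
    exact Complex.ext (by rw [him] at h; linarith) him

theorem exists_compl_homeomorph_compl_finset {G : Set Sphere2} (hG : G.Finite) {a : Sphere2}
    (ha : a ∈ G) : ∃ P : Finset ℂ, P.card + 1 = G.ncard ∧ InjOn re (P : Set ℂ) ∧
      Nonempty ((Gᶜ : Set Sphere2) ≃ₜ ((P : Set ℂ)ᶜ : Set ℂ)) := by
  obtain ⟨φ₀⟩ := nonempty_compl_singleton_homeomorph_complex a
  obtain ⟨s, hs⟩ := exists_homeomorph_injOn_re
    ((hG.preimage Subtype.val_injective.injOn).image φ₀)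
  let φ := φ₀.trans s
  have hfin : (φ '' (Subtype.val ⁻¹' G)).Finite := (hG.preimage Subtype.val_injective.injOn).image φ
  refine ⟨hfin.toFinset, ?_, ?_, ⟨?_⟩⟩
  · rw [← Set.ncard_eq_toFinset_card _ hfin, Set.ncard_image_of_injective _ φ.injective,
      ← Set.ncard_image_of_injective _ Subtype.val_injective, Subtype.image_preimage_coe,
      inter_comm, ← sdiff_eq, Set.ncard_sdiff_singleton_add_one ha hG]
  · rw [hfin.coe_toFinset]
    rintro _ ⟨z, hz, rfl⟩ _ ⟨w, hw, rfl⟩ h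
    exact congrArg s (hs ⟨z, hz, rfl⟩ ⟨w, hw, rfl⟩ h)
  · rw [hfin.coe_toFinset]
    have hsub : Gᶜ ⊆ ({a}ᶜ : Set Sphere2) := fun x hx h ↦ hx (by rwa [mem_singleton_iff.1 h])
    let ι : ((Gᶜ : Set Sphere2)) → ((φ '' (Subtype.val ⁻¹' G))ᶜ : Set ℂ) := fun x ↦
      ⟨φ ⟨x, hsub x.2⟩, fun ⟨z, hz, h⟩ ↦ x.2 (by simpa [φ.injective h] using hz)⟩
    let κ : ((φ '' (Subtype.val ⁻¹' G))ᶜ : Set ℂ) → ((Gᶜ : Set Sphere2)) := fun z ↦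
      ⟨φ.symm z, fun h ↦ z.2 ⟨φ.symm z, h, φ.apply_symm_apply z⟩⟩
    exact ⟨⟨ι, κ, fun x ↦ by simp [ι, κ], fun z ↦ by simp [ι, κ]⟩, by fun_prop, by fun_prop⟩

/-- A weak Riemann–Hurwitz inequality for coverings between punctured planes. -/
theorem IsCoveringMap.card_punctures_le {E X : Type*} [TopologicalSpace E] [TopologicalSpace X]
    {p : E → X} (hp : IsCoveringMap p) {d : ℕ} (hd : 1 ≤ d)
    (hcard : ∀ x, Nat.card (p ⁻¹' {x}) = d) {P Q : Finset ℂ} (hP : InjOn re (P : Set ℂ))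
    (ψ : X ≃ₜ ((P : Set ℂ)ᶜ : Set ℂ)) (φ : E ≃ₜ ((Q : Set ℂ)ᶜ : Set ℂ)) :
    (P.card + 1) * d + 1 ≤ Q.card + 2 * d := by
  classical
  have hQo : IsOpen (Q : Set ℂ)ᶜ := Q.finite_toSet.isClosed.isOpen_compl
  have := hQo.locallyConnectedSpace
  have : LocallyConnectedSpace E := φ.isOpenEmbedding.locallyConnectedSpace
  have hA : ∀ f : E → ℂ, ∃ S : Q.powerset, Continuous f → (∀ y, f y ≠ 0) →
      ∃ g : E → ℂ, Continuous g ∧ ∀ y, f y = (∏ q ∈ S.1, ((φ y : ℂ) - q)) * g y ^ 2 := by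
    intro f
    by_cases hf : Continuous f ∧ ∀ y, f y ≠ 0
    · let f' : ℂ → ℂ := fun z ↦ if hz : z ∈ (Q : Set ℂ)ᶜ then f (φ.symm ⟨z, hz⟩) else 0
      have hf' : ∀ y, f' (φ y) = f y := fun y ↦ by
        have h : (φ y : ℂ) ∈ (Q : Set ℂ)ᶜ := (φ y).2
        simp only [f', dif_pos h, Subtype.coe_eta, φ.symm_apply_apply]
      have hf's : ∀ z : ((Q : Set ℂ)ᶜ : Set ℂ), f' z = f (φ.symm z) := fun z ↦ by
        rw [← hf', φ.apply_symm_apply]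
      obtain ⟨S, hS, g, hg, hfg⟩ := exists_prod_sub_mul_sq Q f'
        (continuousOn_iff_continuous_domRestrict.2
          ((hf.1.comp φ.symm.continuous).congr fun z ↦ (hf's z).symm))
        fun z hz ↦ by rw [hf's ⟨z, hz⟩]; exact hf.2 _
      exact ⟨⟨S, Finset.mem_powerset.2 hS⟩, fun _ _ ↦ ⟨fun y ↦ g (φ y),
        hg.comp_continuous (continuous_subtype_val.comp φ.continuous) fun y ↦ (φ y).2,
        fun y ↦ by rw [← hf', hfg _ (φ y).2]⟩⟩
    · exact ⟨⟨∅, by simp⟩, fun h1 h2 ↦ absurd ⟨h1, h2⟩ hf⟩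
  choose cls hcls using hA
  have hp' : IsCoveringMap (ψ ∘ p) := hp.homeomorph_comp ψ
  have hcard' : ∀ x, Nat.card ((ψ ∘ p) ⁻¹' {x}) = d := fun x ↦ by
    have h : (ψ ∘ p) ⁻¹' {x} = p ⁻¹' {ψ.symm x} := by
      ext y
      simp [ψ.eq_symm_apply]
    rw [h, hcard]
  have key := hp'.two_pow_le_of_sq_classes hP hd hcard' cls fun f f' hf hf' h0 h0' h ↦ by
    obtain ⟨g, hg, hfg⟩ := hcls f hf h0
    obtain ⟨g', hg', hfg'⟩ := hcls f' hf' h0'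
    have hne : ∀ y, g' y ≠ 0 := fun y hy ↦ h0' y (by rw [hfg', hy]; simp)
    refine ⟨fun y ↦ g y / g' y, hg.div hg' hne, fun y ↦ ?_⟩
    rw [hfg, hfg', h]
    have := hne y
    field_simp
  rw [Nat.card_eq_fintype_card, Fintype.card_coe, Finset.card_powerset, ← pow_succ', ← pow_add,
    ← pow_add, Nat.pow_le_pow_iff_right one_lt_two] at key
  omega

theorem connectedSpace_sphere2 : ConnectedSpace Sphere2 :=
  isConnected_iff_connectedSpace.1 <| isConnected_sphere
    (by rw [← Module.finrank_eq_rank, finrank_euclideanSpace_fin]; norm_num) 0 zero_le_one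

theorem nontrivial_sphere2 : Nontrivial Sphere2 := by
  refine ⟨⟨EuclideanSpace.single 0 1, by simp⟩, ⟨EuclideanSpace.single 0 (-1), by simp⟩,
    fun h ↦ ?_⟩
  have := congrFun (congrArg (fun x : Sphere2 ↦ (x : EuclideanSpace ℝ (Fin 3)).ofLp) h) 0
  norm_num at this

namespace IsBranchedCovering

variable {d : ℕ} {π : Sphere2 → Sphere2} {F : Set Sphere2} {e : Sphere2 → ℕ}

theorem map_mem_of_one_lt (hbc : IsBranchedCovering d π F e) {y : Sphere2} (hy : 1 < e y) :
    π y ∈ F := by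
  by_contra h
  exact hy.ne' (hbc.ram_eq_one y h)

theorem exists_mem_nhds_eq (hbc : IsBranchedCovering d π F e) {y : Sphere2} (hy : π y ∈ F) :
    ∃ U ∈ 𝓝 y, ∀ z ∈ U, π z = π y → z = y := by
  obtain ⟨he, U, V, hUo, hVo, hyU, hyV, hmaps, h, g, h0, g0, hg⟩ := hbc.ram y hy
  refine ⟨U, hUo.mem_nhds hyU, fun z hz hzy ↦ ?_⟩
  have h1 : (h ⟨z, hz⟩ : ℂ) = 0 := by
    refine eq_zero_of_pow_eq_zero (n := e y) ?_
    rw [← hg z hz, ← g0]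
    congr 3
  simpa using h.injective (Subtype.ext (h1.trans h0.symm))

theorem finite_fiber (hbc : IsBranchedCovering d π F e) (hd : 1 ≤ d) (x : Sphere2) :
    (π ⁻¹' {x}).Finite := by
  by_cases hx : x ∈ F
  · have hcpt : IsCompact (π ⁻¹' {x}) := (isClosed_singleton.preimage hbc.continuous).isCompact
    choose! U hU hUeq using fun (y : Sphere2) (hy : y ∈ π ⁻¹' {x}) ↦
      hbc.exists_mem_nhds_eq (y := y) (by rwa [mem_singleton_iff.1 hy])
    obtain ⟨t, ht, hsub⟩ := hcpt.elim_nhds_subcover U hU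
    refine t.finite_toSet.subset fun z hz ↦ ?_
    obtain ⟨y, hy, hzy⟩ := mem_iUnion₂.1 (hsub hz)
    rw [hUeq y (ht y hy) z hzy
      ((mem_singleton_iff.1 hz).trans (mem_singleton_iff.1 (ht y hy)).symm)]
    exact hy
  · exact Nat.finite_of_card_ne_zero (by rw [hbc.fiber_card x hx]; omega)

theorem finite_preimage (hbc : IsBranchedCovering d π F e) (hd : 1 ≤ d) : (π ⁻¹' F).Finite :=
  hbc.finiteBranch.preimage' fun x _ ↦ hbc.finite_fiber hd x

theorem finite_setOf_one_lt (hbc : IsBranchedCovering d π F e) (hd : 1 ≤ d) :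
    {y | 1 < e y}.Finite :=
  (hbc.finite_preimage hd).subset fun _ hy ↦ hbc.map_mem_of_one_lt hy

theorem eventually_exists_finset (hbc : IsBranchedCovering d π F e) {y : Sphere2} (hy : π y ∈ F)
    {N : Set Sphere2} (hN : N ∈ 𝓝 y) :
    ∀ᶠ x in 𝓝[≠] (π y), ∃ T : Finset Sphere2, (∀ z ∈ T, z ∈ N ∧ π z = x) ∧
      T.card = 1 + if 1 < e y then 1 else 0 := by
  classical
  obtain ⟨he, U, V, hUo, hVo, hyU, hyV, hmaps, h, g, h0, g0, hg⟩ := hbc.ram y hy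
  have he0 : e y ≠ 0 := by omega
  have hz0 : (0 : ℂ) ∈ unitDisc := by simp
  have hh0 : h.symm ⟨0, hz0⟩ = ⟨y, hyU⟩ := by
    rw [h.symm_apply_eq]; exact Subtype.ext h0.symm
  have hball : ∀ᶠ t in 𝓝 (⟨0, hz0⟩ : unitDisc), (h.symm t : Sphere2) ∈ N := by
    have hc : ContinuousAt (fun t ↦ (h.symm t : Sphere2)) ⟨0, hz0⟩ := by fun_prop
    refine hc.eventually_mem ?_
    simpa [hh0] using hN
  obtain ⟨ε, hε, hεN⟩ := Metric.eventually_nhds_iff.1 hball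
  set δ := min ε 1 with hδ
  have hδ0 : 0 < δ := lt_min hε one_pos
  have hlift : ∀ t : ℂ, ‖t‖ < δ → ∀ x (hx : x ∈ V), t ^ e y = g ⟨x, hx⟩ →
      ∃ (ht : t ∈ unitDisc), (h.symm ⟨t, ht⟩ : Sphere2) ∈ N ∧ π (h.symm ⟨t, ht⟩) = x := by
    intro t ht x hx hgx
    have ht1 : t ∈ unitDisc := by simpa using ht.trans_le (min_le_right _ _)
    refine ⟨ht1, hεN ?_, ?_⟩
    · simpa [Subtype.dist_eq] using ht.trans_le (min_le_left _ _)
    · have h1 := hg _ (h.symm ⟨t, ht1⟩).2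
      simp only [Subtype.coe_eta, Homeomorph.apply_symm_apply, hgx] at h1
      simpa using g.injective (Subtype.ext h1)
  have hsmall : ∀ᶠ x in 𝓝 (π y), ∃ hx : x ∈ V, ‖(g ⟨x, hx⟩ : ℂ)‖ < δ ^ e y := by
    have h1 : ∀ᶠ x in 𝓝 (⟨π y, hyV⟩ : V), ‖(g x : ℂ)‖ < δ ^ e y := by
      have hc : Continuous fun x ↦ ‖(g x : ℂ)‖ := by fun_prop
      refine hc.continuousAt.eventually_lt continuousAt_const ?_
      rw [g0, norm_zero]
      positivity
    rw [nhds_subtype_eq_comap, Filter.eventually_comap] at h1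
    filter_upwards [h1, hVo.mem_nhds hyV] with x hx hxV
    exact ⟨hxV, hx ⟨x, hxV⟩ rfl⟩
  filter_upwards [hsmall.filter_mono nhdsWithin_le_nhds, self_mem_nhdsWithin] with x hx hxy
  obtain ⟨hxV, hxδ⟩ := hx
  obtain ⟨t, ht⟩ := IsAlgClosed.exists_pow_nat_eq (g ⟨x, hxV⟩ : ℂ) (by omega : 0 < e y)
  have htδ : ‖t‖ < δ := by
    rw [← ht, norm_pow] at hxδ
    exact lt_of_pow_lt_pow_left₀ _ hδ0.le hxδ
  have ht0 : t ≠ 0 := by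
    rintro rfl
    rw [zero_pow he0, ← g0] at ht
    exact hxy (by simpa using (g.injective (Subtype.ext ht)).symm)
  obtain ⟨ht1, htN, htx⟩ := hlift t htδ x hxV ht
  by_cases he1 : 1 < e y
  · have hζ := Complex.isPrimitiveRoot_exp (e y) he0
    set ζ := exp (2 * Real.pi * I / e y)
    have hζn : ‖ζ‖ = 1 := hζ.norm'_eq_one he0
    obtain ⟨hs1, hsN, hsx⟩ := hlift (ζ * t) (by rwa [norm_mul, hζn, one_mul]) x hxV
      (by rw [mul_pow, hζ.pow_eq_one, one_mul, ht])
    refine ⟨{(h.symm ⟨t, ht1⟩ : Sphere2), (h.symm ⟨ζ * t, hs1⟩ : Sphere2)}, ?_, ?_⟩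
    · simp [htN, htx, hsN, hsx]
    · rw [if_pos he1, Finset.card_pair]
      intro heq
      have h1 := h.symm.injective (Subtype.ext heq)
      have h2 : t = ζ * t := congrArg Subtype.val h1
      exact hζ.ne_one he1 (mul_right_cancel₀ ht0 (by rw [one_mul, ← h2]))
  · exact ⟨{(h.symm ⟨t, ht1⟩ : Sphere2)}, by simp [htN, htx], by simp [he1]⟩

theorem card_fiber_add_card_critical_le (hbc : IsBranchedCovering d π F e) (hd : 1 ≤ d)
    {p : Sphere2} (hp : p ∈ F) {S : Finset Sphere2} (hS : ∀ y ∈ S, π y = p) :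
    S.card + (S.filter fun y ↦ 1 < e y).card ≤ d := by
  classical
  have := connectedSpace_sphere2
  have := nontrivial_sphere2
  obtain ⟨N, hN, hdisj⟩ := S.finite_toSet.t2_separation
  have hev : ∀ᶠ x in 𝓝[≠] p, ∀ y ∈ S, ∃ T : Finset Sphere2, (∀ z ∈ T, z ∈ N y ∧ π z = x) ∧
      T.card = 1 + if 1 < e y then 1 else 0 := by
    refine (Filter.eventually_all_finset S).2 fun y hy ↦ ?_
    obtain rfl := hS y hy
    exact hbc.eventually_exists_finset hp ((hN y).2.mem_nhds (hN y).1)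
  have hF : ∀ᶠ x in 𝓝[≠] p, x ∉ F := by
    have h1 : ∀ᶠ x in 𝓝 p, x ∉ F \ {p} :=
      (hbc.finiteBranch.sdiff.isClosed.isOpen_compl).mem_nhds (by simp)
    filter_upwards [h1.filter_mono nhdsWithin_le_nhds, self_mem_nhdsWithin] with x hx hxp hxF
    exact hx ⟨hxF, hxp⟩
  obtain ⟨x, hx, hxF⟩ := (hev.and hF).exists
  choose! T hTmem hTcard using hx
  have hunion : (S.biUnion T).card = ∑ y ∈ S, (1 + if 1 < e y then 1 else 0) := by
    rw [Finset.card_biUnion fun y hy y' hy' hne ↦ ?_, Finset.sum_congr rfl hTcard]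
    refine Finset.disjoint_left.2 fun z hz hz' ↦ ?_
    exact Set.disjoint_left.1 (hdisj hy hy' hne) (hTmem y hy z hz).1 (hTmem y' hy' z hz').1
  have hle : (S.biUnion T).card ≤ d := by
    rw [← hbc.fiber_card x hxF, Nat.card_coe_set_eq, ← Set.ncard_coe_finset]
    refine Set.ncard_le_ncard (fun z hz ↦ ?_) (hbc.finite_fiber hd x)
    obtain ⟨y, hy, hz⟩ := Finset.mem_biUnion.1 hz
    exact (hTmem y hy z hz).2
  rw [hunion, Finset.sum_add_distrib] at hle
  simpa using hle

theorem ncard_preimage_add_ncard_critical_le (hbc : IsBranchedCovering d π F e) (hd : 1 ≤ d) :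
    (π ⁻¹' F).ncard + {y | 1 < e y}.ncard ≤ F.ncard * d := by
  classical
  have hY := hbc.finite_preimage hd
  have hF := hbc.finiteBranch
  have hC : {y | 1 < e y} = (hY.toFinset.filter fun y ↦ 1 < e y : Finset Sphere2) := by
    ext y
    simpa using fun hy ↦ hbc.map_mem_of_one_lt hy
  rw [hC, Set.ncard_coe_finset, Set.ncard_eq_toFinset_card _ hY, Set.ncard_eq_toFinset_card _ hF,
    Finset.card_eq_sum_card_fiberwise (f := π) (s := hY.toFinset) (t := hF.toFinset)
      (fun y hy ↦ by simpa using hy),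
    Finset.card_eq_sum_card_fiberwise (f := π) (s := hY.toFinset.filter _) (t := hF.toFinset)
      (fun y hy ↦ by simp at hy; simpa using hy.1), ← Finset.sum_add_distrib]
  refine Finset.sum_le_card_nsmul _ _ _ fun p hp ↦ ?_
  rw [Finset.filter_comm]
  exact hbc.card_fiber_add_card_critical_le hd (by simpa using hp) (by simp)

end IsBranchedCovering

theorem isPreconnected_compl_of_finite {G : Set Sphere2} (hG : G.Finite) :
    IsPreconnected Gᶜ := by
  rcases G.eq_empty_or_nonempty with rfl | ⟨a, ha⟩
  · have := connectedSpace_sphere2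
    simpa using isPreconnected_univ
  · obtain ⟨P, -, -, ⟨φ⟩⟩ := exists_compl_homeomorph_compl_finset hG ha
    have hP : IsConnected (P : Set ℂ)ᶜ :=
      P.countable_toSet.isConnected_compl_of_one_lt_rank (by simp)
    have := isPreconnected_iff_preconnectedSpace.1 hP.isPreconnected
    refine isPreconnected_iff_preconnectedSpace.2 ⟨?_⟩
    rw [← φ.symm.surjective.range_eq]
    exact isPreconnected_range φ.symm.continuous

namespace IsBranchedCovering

variable {d : ℕ} {π : Sphere2 → Sphere2} {F : Set Sphere2} {e : Sphere2 → ℕ}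

theorem isLocalHomeomorphOn (hbc : IsBranchedCovering d π F e) :
    IsLocalHomeomorphOn π {y | ¬ 1 < e y} := by
  rw [isLocalHomeomorphOn_iff_isOpenEmbedding_restrict]
  intro y hy
  by_cases hyF : π y ∈ F
  · obtain ⟨he, U, V, hUo, hVo, hyU, hyV, hmaps, h, g, h0, g0, hg⟩ := hbc.ram y hyF
    have he1 : e y = 1 := le_antisymm (not_lt.1 hy) he
    refine ⟨U, hUo.mem_nhds hyU, ?_⟩
    have heq : U.domRestrict π = Subtype.val ∘ (h.trans g.symm) := by
      ext1 z
      have h1 := hg z z.2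
      rw [he1, pow_one] at h1
      have h2 : g ⟨π z, hmaps z.2⟩ = h z := Subtype.ext h1
      simp [← h2]
    rw [heq]
    exact hVo.isOpenEmbedding_subtypeVal.comp (h.trans g.symm).isOpenEmbedding
  · have hFo : IsOpen Fᶜ := hbc.finiteBranch.isClosed.isOpen_compl
    have hcov : IsCoveringMapOn π Fᶜ :=
      .of_isCoveringMap_restrictPreimage _ hFo (hFo.preimage hbc.continuous) hbc.covering
    exact (isLocalHomeomorphOn_iff_isOpenEmbedding_restrict _).1 hcov.isLocalHomeomorphOn y hyF

theorem two_le_ncard_critical_values (hbc : IsBranchedCovering d π F e) (hd : 2 ≤ d) :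
    2 ≤ (π '' {y | 1 < e y}).ncard := by
  have := nontrivial_sphere2
  have := connectedSpace_sphere2
  by_contra! hlt
  obtain ⟨p, hp⟩ := (Set.ncard_le_one_iff_subset_singleton
    ((hbc.finite_setOf_one_lt (by omega)).image π)).1 (Nat.lt_succ_iff.1 hlt)
  have hloc : IsLocalHomeomorphOn π (π ⁻¹' {p}ᶜ) :=
    hbc.isLocalHomeomorphOn.mono fun y hy h ↦ hy (hp ⟨y, h, rfl⟩)
  have hcov := (IsCoveringMapOn.of_isLocalHomeomorphOn hbc.continuous
    hloc).isCoveringMap_restrictPreimage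
  have hinf : Infinite Sphere2 := by
    obtain ⟨φ⟩ := nonempty_compl_singleton_homeomorph_complex p
    exact Infinite.of_injective _ (Subtype.val_injective.comp φ.symm.injective)
  obtain ⟨x, hx⟩ := (hbc.finiteBranch.insert p).infinite_compl.nonempty
  simp only [mem_compl_iff, mem_insert_iff, not_or] at hx
  have hcard := hbc.fiber_card x hx.2
  have : Finite (π ⁻¹' {x}) := hbc.finite_fiber (by omega) x
  have : Nontrivial (π ⁻¹' {x}) := Finite.one_lt_card_iff_nontrivial.1 (by omega)
  obtain ⟨⟨y, hy⟩, ⟨y', hy'⟩, hne⟩ := exists_pair_ne (π ⁻¹' {x})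
  have hyp : y ∈ π ⁻¹' {p}ᶜ := fun h ↦ hx.1 (hy.symm.trans h)
  have hyp' : y' ∈ π ⁻¹' {p}ᶜ := fun h ↦ hx.1 (hy'.symm.trans h)
  obtain ⟨φ⟩ := nonempty_compl_singleton_homeomorph_complex p
  have := φ.contractibleSpace
  have := φ.isOpenEmbedding.locallyPathConnectedSpace
  have : PreconnectedSpace (π ⁻¹' {p}ᶜ) := isPreconnected_iff_preconnectedSpace.1 <|
    isPreconnected_compl_of_finite (hbc.finite_fiber (by omega) p)
  set q := ({p}ᶜ : Set Sphere2).restrictPreimage π with hq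
  obtain ⟨σ, ⟨hσ0, hσ⟩, -⟩ := hcov.existsUnique_continuousMap_lifts
    (ContinuousMap.id ({p}ᶜ : Set Sphere2)) (q ⟨y, hyp⟩) ⟨y, hyp⟩ rfl
  have key := hcov.eq_of_comp_eq (g₁ := σ ∘ q) (g₂ := id) (σ.continuous.comp hcov.continuous)
    continuous_id (funext fun z ↦ congrFun hσ (q z)) ⟨y, hyp⟩ hσ0
  have hqq : q ⟨y, hyp⟩ = q ⟨y', hyp'⟩ := Subtype.ext (hy.trans hy'.symm)
  have h1 := congrFun key ⟨y, hyp⟩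
  have h2 := congrFun key ⟨y', hyp'⟩
  simp only [Function.comp_apply, id] at h1 h2
  rw [hqq, h2] at h1
  exact hne (by simpa using h1.symm)

theorem ncard_critical_points_le (hbc : IsBranchedCovering d π F e) (hd : 1 ≤ d) :
    {y | 1 < e y}.ncard ≤ 2 * d - 2 := by
  rcases {y | 1 < e y}.eq_empty_or_nonempty with hempty | ⟨q, hq⟩
  · simp [hempty]
  have hqF : π q ∈ F := hbc.map_mem_of_one_lt hq
  obtain ⟨P, hPF, hP, ⟨ψ⟩⟩ := exists_compl_homeomorph_compl_finset hbc.finiteBranch hqF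
  obtain ⟨Q, hQF, -, ⟨φ⟩⟩ := exists_compl_homeomorph_compl_finset (hbc.finite_preimage hd)
    (a := q) hqF
  have hcard : ∀ x : (Fᶜ : Set Sphere2), Nat.card
      ((fun x : ((π ⁻¹' F)ᶜ : Set Sphere2) ↦ (⟨π x.1, x.2⟩ : (Fᶜ : Set Sphere2))) ⁻¹' {x}) = d := by
    intro x
    rw [← hbc.fiber_card x x.2]
    exact Nat.card_congr ⟨fun y ↦ ⟨y.1.1, congrArg Subtype.val y.2⟩,
      fun y ↦ ⟨⟨y.1, fun h ↦ x.2 (by rwa [← mem_singleton_iff.1 y.2])⟩, Subtype.ext y.2⟩,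
      fun _ ↦ rfl, fun _ ↦ rfl⟩
  have h1 := hbc.covering.card_punctures_le hd hcard hP ψ φ
  have h2 := hbc.ncard_preimage_add_ncard_critical_le hd
  rw [hPF] at h1
  omega

end IsBranchedCovering

/-- For a branched covering of degree `d ≥ 2`, the number `n` of critical values and the
number `m` of critical points satisfy `2 ≤ n ≤ m ≤ 2d - 2`. -/
theorem critical_counts (d : ℕ) (hd : 2 ≤ d) (π : Sphere2 → Sphere2) (F : Set Sphere2)
    (e : Sphere2 → ℕ) (hbc : IsBranchedCovering d π F e) :
    2 ≤ (π '' {y : Sphere2 | 1 < e y}).ncard ∧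
    (π '' {y : Sphere2 | 1 < e y}).ncard ≤ {y : Sphere2 | 1 < e y}.ncard ∧
    {y : Sphere2 | 1 < e y}.ncard ≤ 2 * d - 2 :=
  ⟨hbc.two_le_ncard_critical_values hd,
    Set.ncard_image_le (hbc.finite_setOf_one_lt (by omega)),
    hbc.ncard_critical_points_le (by omega)⟩
end
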